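/- arXiv:1711.01622 — 2 statements merged into one kernel-verified Lean document; each statement's English description precedes it below -/
import Mathlib

section
/- For every positive integer n and every subset E = {e_1,...,e_k} of {1,...,n−1}, the number of EW-tableaux of size n whose set of row labels is {0, e_1, ..., e_k} equals the number of n-permutations whose excedance bottoms set is {e_1,...,e_k}. -/
/-- A Ferrers diagram (shape): `r` rows; row `i` (for `i < r`) has `len i` cells,
left-aligned, with row lengths weakly decreasing from top to bottom and positive.
`len` is normalized to vanish for `i ≥ r`. -/
structure FerrersShape where
  r : ℕ
  len : ℕ → ℕ
  r_pos : 0 < r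
  anti : ∀ i j, i ≤ j → j < r → len j ≤ len i
  len_pos : ∀ i, i < r → 0 < len i
  len_zero : ∀ i, r ≤ i → len i = 0

/-- An EW-tableau of shape `F` (`one` normalized to `false` outside the diagram). -/
structure EWTableau (F : FerrersShape) where
  one : ℕ → ℕ → Bool
  support : ∀ i j, one i j = true → i < F.r ∧ j < F.len i
  top_row : ∀ j, j < F.len 0 → one 0 j = true
  has_zero : ∀ i, 0 < i → i < F.r → ∃ j, j < F.len i ∧ one i j = false
  no_rect : ∀ i i' j j', i < i' → i' < F.r → j < j' → j' < F.len i' →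
    ¬(one i j = one i' j' ∧ one i j' = one i' j ∧ one i j ≠ one i j')

/-- The label of row `i` in the southeast-border labeling `0,1,…,n`
(the top row gets label 0). -/
def rowLabel (F : FerrersShape) (i : ℕ) : ℕ := i + (F.len 0 - F.len i)

/-- An `n`-permutation, encoded as a map `a : ℕ → ℕ` permuting `{1,…,n}`
(normalized to `0` off `{1,…,n}`); `a i` is the letter in place `i`. -/
def IsPermOn (n : ℕ) (a : ℕ → ℕ) : Prop :=
  Set.BijOn a (Set.Icc 1 n) (Set.Icc 1 n) ∧ ∀ i, i ∉ Set.Icc 1 n → a i = 0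

/-- The excedance bottoms set of an `n`-permutation: `{i : a_i > i}`. -/
def ExcBottoms (n : ℕ) (a : ℕ → ℕ) : Set ℕ := {i | 1 ≤ i ∧ i ≤ n ∧ i < a i}
namespace EWProof

theorem ncard_biUnion {α : Type*} (s : Finset ℕ) (t : ℕ → Set α) (hf : ∀ i ∈ s, (t i).Finite)
    (hd : ∀ i ∈ s, ∀ j ∈ s, i ≠ j → Disjoint (t i) (t j)) :
    (⋃ i ∈ s, t i).ncard = ∑ i ∈ s, (t i).ncard := by
  induction s using Finset.induction_on with
  | empty => simp
  | insert a s ha ih =>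
    have hfin : (⋃ i ∈ s, t i).Finite := Set.Finite.biUnion (Finset.finite_toSet s)
        (fun i hi => hf i (Finset.mem_insert_of_mem hi))
    have hdis : Disjoint (t a) (⋃ i ∈ s, t i) := by
      simp only [Set.disjoint_iUnion_right]
      intro i hi
      exact hd a (Finset.mem_insert_self _ _) i (Finset.mem_insert_of_mem hi)
        (by rintro rfl; exact ha hi)
    rw [Finset.set_biUnion_insert, Finset.sum_insert ha,
      Set.ncard_union_eq hdis (hf a (Finset.mem_insert_self _ _)) hfin, ih]
    · exact fun i hi => hf i (Finset.mem_insert_of_mem hi)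
    · exact fun i hi j hj => hd i (Finset.mem_insert_of_mem hi) j (Finset.mem_insert_of_mem hj)

/-- `x'` may stand directly before `x` in a word. -/
def Compat (R : Finset ℕ) (x' x : ℕ) : Prop := (x' ∈ R ∧ x' < x) ∨ (x' ∉ R ∧ x < x')

instance (R : Finset ℕ) (x' x : ℕ) : Decidable (Compat R x' x) := by
  unfold Compat; infer_instance

/-- Row `r` and column `c` are adjacent in the Ferrers graph on `U`. -/
def Adj (R U : Finset ℕ) (r c : ℕ) : Prop := r ∈ U ∧ c ∈ U ∧ r ∈ R ∧ c ∉ R ∧ r < c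

def IsSink (R U : Finset ℕ) (o : ℕ → ℕ → Bool) (v : ℕ) : Prop :=
  v ∈ U ∧ ∀ w, (Adj R U v w → o v w = true) ∧ (Adj R U w v → o w v = false)

def NoRect (R U : Finset ℕ) (o : ℕ → ℕ → Bool) : Prop :=
  ∀ r r' c c', Adj R U r c → Adj R U r c' → Adj R U r' c → Adj R U r' c' →
    o r c = true → o r' c = false → o r' c' = true → o r c' = false → False

def OR (R U : Finset ℕ) (x : ℕ) : Set (ℕ → ℕ → Bool) :=
  {o | (∀ r c, o r c = true → Adj R U r c) ∧ NoRect R U o ∧ IsSink R U o x ∧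
    ∀ v, IsSink R U o v → v ≠ x → ((v ∈ R ↔ x ∈ R) ∧ Compat R v x)}

/-- number of words -/
def M : ℕ → Finset ℕ → Finset ℕ → ℕ → ℕ
  | 0, _, _, _ => 1
  | k + 1, R, V, x => ∑ x' ∈ V with Compat R x' x, M k R (V.erase x') x'

theorem exists_sink (R : Finset ℕ) (o : ℕ → ℕ → Bool) :
    ∀ (k : ℕ) (U : Finset ℕ), U.card = k → U.Nonempty → NoRect R U o → ∃ v, IsSink R U o v := by
  intro k
  induction k using Nat.strong_induction_on with
  | _ k ih =>
  intro U hk hU hN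
  classical
  by_cases hC : (U.filter (· ∉ R)).Nonempty
  · set c1 := (U.filter (· ∉ R)).max' hC with hc1
    have hc1m : c1 ∈ U ∧ c1 ∉ R := by
      have := Finset.max'_mem _ hC
      simpa using this
    have hmax : ∀ c ∈ U, c ∉ R → c ≤ c1 := fun c h1 h2 =>
      Finset.le_max' _ c (by simp [h1, h2])
    let A := U.filter (fun r => Adj R U r c1 ∧ o r c1 = true)
    have hA : ∀ r, r ∈ A ↔ Adj R U r c1 ∧ o r c1 = true := by
      intro r; simp only [A, Finset.mem_filter]; unfold Adj; tauto
    by_cases hAe : A.Nonempty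
    · let B := U.filter (fun c => c ≠ c1 ∧ ∃ a ∈ A, Adj R U a c ∧ o a c = false)
      have hB : ∀ c, c ∈ B ↔ c ≠ c1 ∧ ∃ a ∈ A, Adj R U a c ∧ o a c = false := by
        intro r; simp only [B, Finset.mem_filter]; unfold Adj; tauto
      have hsub : A ∪ B ⊆ U := by
        apply Finset.union_subset <;> exact Finset.filter_subset _ _
      have hnot : c1 ∉ A ∪ B := by
        rw [Finset.mem_union, hA, hB]
        unfold Adj; tauto
      have hlt : (A ∪ B).card < k := by
        rw [← hk]
        apply Finset.card_lt_card
        refine ⟨hsub, fun h => hnot (h hc1m.1)⟩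
      have hAdj : ∀ r c, Adj R (A ∪ B) r c → Adj R U r c := by
        rintro r c ⟨h1, h2, h3⟩; exact ⟨hsub h1, hsub h2, h3⟩
      obtain ⟨v, hv1, hv2⟩ := ih _ hlt (A ∪ B) rfl (hAe.mono Finset.subset_union_left)
        (fun r r' c c' h1 h2 h3 h4 => hN r r' c c' (hAdj _ _ h1) (hAdj _ _ h2) (hAdj _ _ h3) (hAdj _ _ h4))
      refine ⟨v, hsub hv1, fun w => ⟨?_, ?_⟩⟩
      · intro hvw
        by_contra hne
        have hne : o v w = false := by simpa using hne
        have hvA : v ∈ A := by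
          rcases Finset.mem_union.1 hv1 with h | h
          · exact h
          · obtain ⟨_, a, _, ha, _⟩ := (hB v).1 h
            exact absurd hvw.2.2.1 ha.2.2.2.1
        have hw1 : w ≠ c1 := by
          rintro rfl; have := ((hA v).1 hvA).2; simp_all
        have hwB : w ∈ B := (hB w).2 ⟨hw1, v, hvA, hvw, hne⟩
        have := (hv2 w).1 ⟨hv1, Finset.mem_union_right _ hwB, hvw.2.2⟩
        simp_all
      · intro hwv
        by_contra hne
        have hne : o w v = true := by simpa using hne
        have hvB : v ∈ B := by
          rcases Finset.mem_union.1 hv1 with h | h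
          · exact absurd ((hA v).1 h).1.2.2.1 hwv.2.2.2.1
          · exact h
        obtain ⟨hvc, a, haA, hav, hoa⟩ := (hB v).1 hvB
        have hle := hmax v hwv.2.1 hwv.2.2.2.1
        have hwc : Adj R U w c1 := ⟨hwv.1, hc1m.1, hwv.2.2.1, hc1m.2, lt_of_lt_of_le hwv.2.2.2.2 hle⟩
        by_cases hw : o w c1 = true
        · have hwA := (hA w).2 ⟨hwc, hw⟩
          have := (hv2 w).2 ⟨Finset.mem_union_left _ hwA, hv1, hwv.2.2⟩
          simp_all
        · exact hN w a v c1 hwv hwc hav ((hA a).1 haA).1 hne hoa ((hA a).1 haA).2 (by simpa using hw)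
    · refine ⟨c1, hc1m.1, fun w => ⟨fun h => absurd h.2.2.1 hc1m.2, fun h => ?_⟩⟩
      by_contra hne
      exact hAe ⟨w, (hA w).2 ⟨h, by simpa using hne⟩⟩
  · obtain ⟨v, hv⟩ := hU
    have hall : ∀ c ∈ U, c ∈ R := by
      intro c hc; by_contra h; exact hC ⟨c, by simp [hc, h]⟩
    exact ⟨v, hv, fun w => ⟨fun h => absurd (hall w h.2.1) h.2.2.2.1,
      fun h => absurd (hall v hv) h.2.2.2.1⟩⟩

def res (x : ℕ) (o : ℕ → ℕ → Bool) : ℕ → ℕ → Bool := fun r c => if r = x then false else o r c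

open Classical in
noncomputable def ext (R V : Finset ℕ) (x : ℕ) (o : ℕ → ℕ → Bool) : ℕ → ℕ → Bool :=
  fun r c => if r = x then decide (Adj R (insert x V) x c) else o r c

theorem res_mem (R V : Finset ℕ) (x : ℕ) (hx : x ∉ V) (hV : V.Nonempty) (o : ℕ → ℕ → Bool)
    (ho : o ∈ OR R (insert x V) x) :
    ∃ x' ∈ V, Compat R x' x ∧ res x o ∈ OR R V x' := by
  obtain ⟨hs, hN, hx1, hx2⟩ := ho
  have hAdj : ∀ r c, Adj R V r c → Adj R (insert x V) r c := by
    rintro r c ⟨h1, h2, h3⟩; exact ⟨Finset.mem_insert_of_mem h1, Finset.mem_insert_of_mem h2, h3⟩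
  have hres : ∀ r c, r ∈ V → res x o r c = o r c := by
    intro r c hr
    have : r ≠ x := by rintro rfl; exact hx hr
    simp [res, this]
  have hN' : NoRect R V (res x o) := by
    intro r r' c c' h1 h2 h3 h4
    rw [hres _ _ h1.1, hres _ _ h1.1, hres _ _ h3.1, hres _ _ h3.1]
    exact hN r r' c c' (hAdj _ _ h1) (hAdj _ _ h2) (hAdj _ _ h3) (hAdj _ _ h4)
  have hsupp : ∀ r c, res x o r c = true → Adj R V r c := by
    intro r c h
    by_cases hr : r = x
    · simp [res, hr] at h
    · simp only [res, hr, if_false] at h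
      have hh := hs r c h
      have hc : c ≠ x := by
        rintro rfl
        have := (hx1.2 r).2 hh
        simp_all
      obtain ⟨h1, h2, h3⟩ := hh
      exact ⟨Finset.mem_of_mem_insert_of_ne h1 hr, Finset.mem_of_mem_insert_of_ne h2 hc, h3⟩
  -- every sink of the restriction is compatible
  have key : ∀ v, IsSink R V (res x o) v → Compat R v x := by
    intro v hv
    have hvx : v ≠ x := by rintro rfl; exact hx hv.1
    by_contra hc
    have hsink : IsSink R (insert x V) o v := by
      refine ⟨Finset.mem_insert_of_mem hv.1, fun w => ⟨fun h => ?_, fun h => ?_⟩⟩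
      · have hw : w ≠ x := by
          rintro rfl; exact hc (Or.inl ⟨h.2.2.1, h.2.2.2.2⟩)
        rw [← hres _ _ hv.1]
        exact (hv.2 w).1 ⟨hv.1, Finset.mem_of_mem_insert_of_ne h.2.1 hw, h.2.2⟩
      · have hw : w ≠ x := by
          rintro rfl; exact hc (Or.inr ⟨h.2.2.2.1, h.2.2.2.2⟩)
        have hwV := Finset.mem_of_mem_insert_of_ne h.1 hw
        rw [← hres _ _ hwV]
        exact (hv.2 w).2 ⟨hwV, hv.1, h.2.2⟩
    exact hc (hx2 v hsink hvx).2
  obtain ⟨v, hv⟩ := exists_sink R (res x o) _ V rfl hV hN'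
  have mono : ∀ v w, IsSink R V (res x o) v → IsSink R V (res x o) w → v ∈ R → w ∈ R := by
    intro v w hv hw hvR
    by_contra hwR
    have h1 := key v hv
    have h2 := key w hw
    have hlt : v < w := by unfold Compat at h1 h2; simp [hvR, hwR] at h1 h2; omega
    have hadj : Adj R V v w := ⟨hv.1, hw.1, hvR, hwR, hlt⟩
    have h3 := (hv.2 w).1 hadj
    have h4 := (hw.2 v).2 hadj
    simp_all
  classical
  let S := V.filter (fun v => IsSink R V (res x o) v)
  have hS : ∀ v, v ∈ S ↔ IsSink R V (res x o) v := by
    intro v; simp only [S, Finset.mem_filter]; exact ⟨fun h => h.2, fun h => ⟨h.1, h⟩⟩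
  have hSne : S.Nonempty := ⟨v, (hS v).2 hv⟩
  by_cases hvR : v ∈ R
  · have hm := (hS _).1 (Finset.max'_mem S hSne)
    refine ⟨S.max' hSne, hm.1, key _ hm, hsupp, hN', hm, ?_⟩
    intro w hw hne
    have hwR := mono v w hv hw hvR
    have := Finset.le_max' S w ((hS w).2 hw)
    exact ⟨⟨fun _ => mono v _ hv hm hvR, fun _ => hwR⟩, Or.inl ⟨hwR, lt_of_le_of_ne this hne⟩⟩
  · have hm := (hS _).1 (Finset.min'_mem S hSne)
    refine ⟨S.min' hSne, hm.1, key _ hm, hsupp, hN', hm, ?_⟩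
    intro w hw hne
    have hwR : w ∉ R := fun h => hvR (mono w v hw hv h)
    have hmR : S.min' hSne ∉ R := fun h => hvR (mono _ v hm hv h)
    have := Finset.min'_le S w ((hS w).2 hw)
    exact ⟨⟨fun h => absurd h hwR, fun h => absurd h hmR⟩, Or.inr ⟨hwR, lt_of_le_of_ne this (Ne.symm hne)⟩⟩

theorem ext_mem (R V : Finset ℕ) (x x' : ℕ) (hx : x ∉ V) (hc : Compat R x' x)
    (o : ℕ → ℕ → Bool) (ho : o ∈ OR R V x') : ext R V x o ∈ OR R (insert x V) x := by
  obtain ⟨hs, hN, hx1, hx2⟩ := ho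
  have hext : ∀ r c, r ≠ x → ext R V x o r c = o r c := by
    intro r c hr; simp [ext, hr]
  have hextx : ∀ c, ext R V x o x c = true ↔ Adj R (insert x V) x c := by
    intro c; simp [ext]
  have hAdj : ∀ r c, Adj R V r c → Adj R (insert x V) r c := by
    rintro r c ⟨h1, h2, h3⟩; exact ⟨Finset.mem_insert_of_mem h1, Finset.mem_insert_of_mem h2, h3⟩
  have hAdj' : ∀ r c, Adj R (insert x V) r c → r ≠ x → c ≠ x → Adj R V r c := by
    rintro r c ⟨h1, h2, h3⟩ h4 h5
    exact ⟨Finset.mem_of_mem_insert_of_ne h1 h4, Finset.mem_of_mem_insert_of_ne h2 h5, h3⟩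
  have hcol : ∀ r, r ≠ x → ext R V x o r x = false := by
    intro r hr
    rw [hext r x hr]
    by_contra h
    exact hx (hs r x (by simpa using h)).2.1
  have hsx : IsSink R (insert x V) (ext R V x o) x := by
    refine ⟨Finset.mem_insert_self _ _, fun w => ⟨fun h => (hextx w).2 h, fun h => ?_⟩⟩
    exact hcol w (ne_of_lt h.2.2.2.2)
  refine ⟨?_, ?_, hsx, ?_⟩
  · intro r c h
    by_cases hr : r = x
    · subst hr; exact (hextx c).1 h
    · rw [hext r c hr] at h; exact hAdj _ _ (hs r c h)
  · intro r r' c c' h1 h2 h3 h4 e1 e2 e3 e4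
    have hr : r ≠ x := by
      rintro rfl; rw [(hextx c').2 h2] at e4; simp at e4
    have hr' : r' ≠ x := by
      rintro rfl; rw [(hextx c).2 h3] at e2; simp at e2
    have hcx : c ≠ x := by
      rintro rfl; rw [hcol r hr] at e1; simp at e1
    have hcx' : c' ≠ x := by
      rintro rfl; rw [hcol r' hr'] at e3; simp at e3
    rw [hext _ _ hr] at e1 e4
    rw [hext _ _ hr'] at e2 e3
    exact hN r r' c c' (hAdj' _ _ h1 hr hcx) (hAdj' _ _ h2 hr hcx') (hAdj' _ _ h3 hr' hcx)
      (hAdj' _ _ h4 hr' hcx') e1 e2 e3 e4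
  · intro v hv hvx
    have hvV := Finset.mem_of_mem_insert_of_ne hv.1 hvx
    have hsv : IsSink R V o v := by
      refine ⟨hvV, fun w => ⟨fun h => ?_, fun h => ?_⟩⟩
      · rw [← hext v w hvx]; exact (hv.2 w).1 (hAdj _ _ h)
      · have hw : w ≠ x := by rintro rfl; exact hx h.1
        rw [← hext w v hw]; exact (hv.2 w).2 (hAdj _ _ h)
    have hcv : Compat R v x := by
      by_cases hvx' : v = x'
      · rw [hvx']; exact hc
      · have := hx2 v hsv hvx'
        unfold Compat at *
        grind
    refine ⟨?_, hcv⟩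
    have a1 : ¬ Adj R (insert x V) v x := by
      intro h
      have h1 := (hv.2 x).1 h
      rw [hcol v hvx] at h1; simp at h1
    have a2 : ¬ Adj R (insert x V) x v := by
      intro h
      have h1 := (hv.2 x).2 h
      rw [(hextx v).2 h] at h1; simp at h1
    have b1 := hv.1
    have b2 := hsx.1
    unfold Adj at a1 a2
    unfold Compat at hcv
    tauto

theorem res_ext (R V : Finset ℕ) (x x' : ℕ) (hx : x ∉ V) (o : ℕ → ℕ → Bool) (ho : o ∈ OR R V x') :
    res x (ext R V x o) = o := by
  funext r c
  by_cases hr : r = x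
  · subst hr
    simp only [res, if_true]
    symm
    by_contra h
    exact hx (ho.1 r c (by simpa using h)).1
  · simp [res, ext, hr]

theorem ext_res (R V : Finset ℕ) (x : ℕ) (o : ℕ → ℕ → Bool) (ho : o ∈ OR R (insert x V) x) :
    ext R V x (res x o) = o := by
  funext r c
  by_cases hr : r = x
  · subst hr
    by_cases h : Adj R (insert r V) r c
    · simp [ext, h, (ho.2.2.1.2 c).1 h]
    · have : o r c = false := by
        by_contra h'
        exact h (ho.1 r c (by simpa using h'))
      simp [ext, h, this]
  · simp [res, ext, hr]

theorem OR_finite (R U : Finset ℕ) (x : ℕ) : (OR R U x).Finite := by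
  apply Set.Finite.of_finite_image (f := fun o => (U ×ˢ U).filter (fun p => o p.1 p.2 = true))
  · exact Set.Finite.subset (Finset.finite_toSet (U ×ˢ U).powerset) (by
      rintro _ ⟨o, _, rfl⟩
      rw [Finset.mem_coe, Finset.mem_powerset]
      exact Finset.filter_subset _ _)
  · intro o ho o' ho' h
    have h : ∀ r c, (r ∈ U ∧ c ∈ U) → (o r c = true ↔ o' r c = true) := by
      intro r c ⟨h1, h2⟩
      have := congrArg (fun s => (r, c) ∈ s) h
      simpa [h1, h2] using this
    funext r c
    rw [Bool.eq_iff_iff]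
    constructor
    · intro h1
      have := ho.1 r c h1
      exact (h r c ⟨this.1, this.2.1⟩).1 h1
    · intro h1
      have := ho'.1 r c h1
      exact (h r c ⟨this.1, this.2.1⟩).2 h1

theorem OR_disjoint (R V : Finset ℕ) (x x' : ℕ) (h : x ≠ x') : Disjoint (OR R V x) (OR R V x') := by
  rw [Set.disjoint_left]
  intro o h1 h2
  have a := h1.2.2.2 x' h2.2.2.1 (Ne.symm h)
  have b := h2.2.2.2 x h1.2.2.1 h
  unfold Compat at a b
  grind

theorem OR_ncard (R : Finset ℕ) : ∀ (k : ℕ) (V : Finset ℕ) (x : ℕ), V.card = k → x ∉ V →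
    (OR R (insert x V) x).ncard = M k R V x := by
  intro k
  induction k with
  | zero =>
    intro V x hV hx
    rw [Finset.card_eq_zero] at hV
    subst hV
    have hA : ∀ r c, ¬ Adj R (insert x ∅) r c := by
      rintro r c ⟨h1, h2, h3, h4, h5⟩
      simp at h1 h2; omega
    have : OR R (insert x ∅) x = {fun _ _ => false} := by
      ext o
      simp only [Set.mem_singleton_iff]
      constructor
      · intro ho
        funext r c
        by_contra h
        exact hA r c (ho.1 r c (by simpa using h))
      · rintro rfl
        refine ⟨by simp, ?_, ?_, ?_⟩
        · intro r r' c c' _ _ _ _ h; simp at h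
        · exact ⟨by simp, fun w => ⟨fun h => absurd h (hA _ _), fun h => absurd h (hA _ _)⟩⟩
        · intro v hv hne
          have := hv.1
          simp at this; exact absurd this hne
    rw [this, Set.ncard_singleton]; rfl
  | succ k ih =>
    intro V x hV hx
    have hVne : V.Nonempty := by rw [← Finset.card_pos]; omega
    have himg : (OR R (insert x V) x).ncard
        = (⋃ x' ∈ V.filter (fun x' => Compat R x' x), OR R V x').ncard := by
      apply Set.ncard_congr (fun o _ => res x o)
      · intro o ho
        obtain ⟨x', h1, h2, h3⟩ := res_mem R V x hx hVne o ho
        simp only [Set.mem_iUnion]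
        exact ⟨x', by simp [h1, h2], h3⟩
      · intro o o' ho ho' h
        have h : res x o = res x o' := h
        rw [← ext_res R V x o ho, h, ext_res R V x o' ho']
      · intro o ho
        simp only [Set.mem_iUnion, Finset.mem_filter] at ho
        obtain ⟨x', ⟨h1, h2⟩, h3⟩ := ho
        exact ⟨ext R V x o, ext_mem R V x x' hx h2 o h3, res_ext R V x x' hx o h3⟩
    rw [himg]
    rw [ncard_biUnion _ _ (fun x' _ => OR_finite R V x') (fun a _ b _ h => OR_disjoint R V a b h)]
    simp only [M]
    apply Finset.sum_congr rfl
    intro x' hx'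
    rw [Finset.mem_filter] at hx'
    rw [← ih (V.erase x') x' (by rw [Finset.card_erase_of_mem hx'.1]; omega) (by simp),
      Finset.insert_erase hx'.1]

end EWProof
namespace EWProof

theorem M_congr : ∀ (k : ℕ) (R R' V : Finset ℕ) (x : ℕ), (∀ v ∈ V, v ∈ R ↔ v ∈ R') →
    M k R V x = M k R' V x := by
  intro k
  induction k with
  | zero => intros; rfl
  | succ k ih =>
    intro R R' V x h
    simp only [M]
    have : V.filter (fun x' => Compat R x' x) = V.filter (fun x' => Compat R' x' x) := by
      apply Finset.filter_congr
      intro v hv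
      unfold Compat; rw [h v hv]
    rw [this]
    apply Finset.sum_congr rfl
    intro x' _
    exact ih _ _ _ _ (fun v hv => h v (Finset.mem_of_mem_erase hv))

theorem M_zero : ∀ (k : ℕ) (R V : Finset ℕ) (x m : ℕ), V.card = k → m ∈ V → m ∈ R →
    (∀ v ∈ V, v ≤ m) → x < m → M k R V x = 0 := by
  intro k
  induction k with
  | zero => intro R V x m h1 h2; rw [Finset.card_eq_zero] at h1; subst h1; simp at h2
  | succ k ih =>
    intro R V x m h1 h2 h3 h4 h5
    simp only [M]
    apply Finset.sum_eq_zero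
    intro x' hx'
    rw [Finset.mem_filter] at hx'
    have hne : x' ≠ m := by
      rintro rfl
      have := hx'.2
      unfold Compat at this
      simp [h3] at this; omega
    exact ih R _ x' m (by rw [Finset.card_erase_of_mem hx'.1]; omega)
      (Finset.mem_erase.2 ⟨hne.symm, h2⟩) h3 (fun v hv => h4 v (Finset.mem_of_mem_erase hv))
      (lt_of_le_of_ne (h4 x' hx'.1) hne)

theorem M_insert : ∀ (k : ℕ) (R V : Finset ℕ) (x m : ℕ), V.card = k → x ∉ V →
    (∀ v ∈ V, v < m) → x < m → m ∉ R →
    M (k + 1) R (insert m V) x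
      = M k R V x + ∑ y ∈ V with y ∈ R, (M k R V x + M k (R.erase y) V x) := by
  intro k
  induction k with
  | zero =>
    intro R V x m h1 hx hm hxm hmR
    rw [Finset.card_eq_zero] at h1
    subst h1
    simp [M, Compat, hmR, hxm, Finset.filter_insert, Finset.filter_singleton]
  | succ k ih =>
    intro R V x m h1 hx hm hxm hmR
    have hmV : m ∉ V := fun h => lt_irrefl _ (hm m h)
    have hcard : ∀ v ∈ V, (V.erase v).card = k := by
      intro v hv; rw [Finset.card_erase_of_mem hv]; omega
    have e1 : M (k + 2) R (insert m V) x
        = M (k + 1) R V m + ∑ v ∈ V with Compat R v x, M (k + 1) R (insert m (V.erase v)) v := by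
      rw [show M (k+2) R (insert m V) x = ∑ x' ∈ insert m V with Compat R x' x,
        M (k+1) R ((insert m V).erase x') x' from rfl]
      rw [Finset.filter_insert, if_pos (show Compat R m x from Or.inr ⟨hmR, hxm⟩),
        Finset.sum_insert (by simp [hmV]), Finset.erase_insert hmV]
      congr 1
      apply Finset.sum_congr rfl
      intro v hv
      rw [Finset.mem_filter] at hv
      rw [Finset.erase_insert_of_ne (by rintro rfl; exact hmV hv.1)]
    have e2 : M (k + 1) R V m = ∑ v ∈ V, if v ∈ R then M k R (V.erase v) v else 0 := by
      simp only [M]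
      rw [← Finset.sum_filter]
      apply Finset.sum_congr _ (fun _ _ => rfl)
      apply Finset.filter_congr
      intro v hv
      have := hm v hv
      unfold Compat
      constructor
      · rintro (h | h)
        · exact h.1
        · omega
      · intro h; exact Or.inl ⟨h, this⟩
    have e3 : ∀ v ∈ V, M (k + 1) R (insert m (V.erase v)) v
        = M k R (V.erase v) v + ∑ y ∈ V, if y ∈ R ∧ y ≠ v then
          (M k R (V.erase v) v + M k (R.erase y) (V.erase v) v) else 0 := by
      intro v hv
      rw [ih R (V.erase v) v m (hcard v hv) (by simp)
        (fun w hw => hm w (Finset.mem_of_mem_erase hw)) (hm v hv) hmR]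
      congr 1
      rw [← Finset.sum_filter]
      apply Finset.sum_congr _ (fun _ _ => rfl)
      ext y; simp; tauto
    have e4 : ∀ R', M (k + 1) R' V x = ∑ v ∈ V, if Compat R' v x then M k R' (V.erase v) v else 0 := by
      intro R'
      simp only [M]
      rw [← Finset.sum_filter]
    have e5 : ∀ v, M k (R.erase v) (V.erase v) v = M k R (V.erase v) v := by
      intro v
      apply M_congr
      intro w hw
      have := Finset.ne_of_mem_erase hw
      simp [this]
    rw [e1, e2, e4 R, Finset.sum_filter, Finset.sum_filter]
    simp only [e4]
    have e6 : ∀ y, (if y ∈ R then (∑ v ∈ V, if Compat R v x then M k R (V.erase v) v else 0)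
        + (∑ v ∈ V, if Compat (R.erase y) v x then M k (R.erase y) (V.erase v) v else 0) else 0)
        = ∑ v ∈ V, if y ∈ R then (if Compat R v x then M k R (V.erase v) v else 0)
          + (if Compat (R.erase y) v x then M k (R.erase y) (V.erase v) v else 0) else 0 := by
      intro y
      split_ifs
      · rw [Finset.sum_add_distrib]
      · simp
    simp only [e6]
    rw [Finset.sum_comm, ← Finset.sum_add_distrib, ← Finset.sum_add_distrib]
    apply Finset.sum_congr rfl
    intro v hv
    have hvx : v ≠ x := by rintro rfl; exact hx hv
    -- split the sum over y at y = v
    rw [← Finset.add_sum_erase V _ hv]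
    have e7 : (∑ y ∈ V.erase v, if y ∈ R then (if Compat R v x then M k R (V.erase v) v else 0)
          + (if Compat (R.erase y) v x then M k (R.erase y) (V.erase v) v else 0) else 0)
        = if Compat R v x then (∑ y ∈ V, if y ∈ R ∧ y ≠ v then
          (M k R (V.erase v) v + M k (R.erase y) (V.erase v) v) else 0) else 0 := by
      rw [← Finset.add_sum_erase V _ hv]
      have : ∀ y ∈ V.erase v, (Compat (R.erase y) v x ↔ Compat R v x) := by
        intro y hy
        have := Finset.ne_of_mem_erase hy
        unfold Compat
        simp [this.symm]
      by_cases h : Compat R v x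
      · simp only [h, if_true, ne_eq, not_true_eq_false, and_false, if_false, zero_add]
        apply Finset.sum_congr rfl
        intro y hy
        have h2 := (this y hy).2 h
        have h3 := Finset.ne_of_mem_erase hy
        simp [h2, h3]
      · simp only [h, if_false]
        apply Finset.sum_eq_zero
        intro y hy
        have h2 : ¬ Compat (R.erase y) v x := fun h' => h ((this y hy).1 h')
        simp [h2]
    rw [e7, e5 v, e3 v hv]
    have hcc : v ∈ R → (Compat (R.erase v) v x ↔ ¬ Compat R v x) := by
      intro h; unfold Compat; simp [h]; omega
    by_cases hvR : v ∈ R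
    · have := hcc hvR
      by_cases hc : Compat R v x
      · simp [hvR, this, hc]
      · simp [hvR, this, hc]
    · by_cases hc : Compat R v x
      · simp [hvR, hc]
      · simp [hvR, hc]

/-- permutations of `ℕ` moving only `1..n`, with given excedance set -/
def PE (n : ℕ) (E : Finset ℕ) : Set (Equiv.Perm ℕ) :=
  {σ | (∀ i, i ∉ Set.Icc 1 n → σ i = i) ∧ {i | i < σ i} = (E : Set ℕ)}

theorem PE_bound {n : ℕ} {σ : Equiv.Perm ℕ} (h : ∀ i, i ∉ Set.Icc 1 n → σ i = i) {i : ℕ}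
    (hi : i ∈ Set.Icc 1 n) : σ i ∈ Set.Icc 1 n := by
  by_contra hn
  have := σ.injective (h _ hn)
  rw [this] at hn
  exact hn hi

theorem PE_finite (n : ℕ) (E : Finset ℕ) : (PE n E).Finite := by
  apply Set.Finite.of_finite_image
    (f := fun σ => fun i : Fin (n + 1) => (⟨min (σ i) n, by omega⟩ : Fin (n + 1)))
  · exact Set.toFinite _
  · intro σ hσ τ hτ h
    ext i
    by_cases hi : i ∈ Set.Icc 1 n
    · have h1 := PE_bound hσ.1 hi
      have h2 := PE_bound hτ.1 hi
      have h3 := congrFun h ⟨i, by have := hi.2; omega⟩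
      simp only [Fin.mk.injEq] at h3
      rw [min_eq_left h1.2, min_eq_left h2.2] at h3
      exact h3
    · rw [hσ.1 i hi, hτ.1 i hi]

theorem PE_zero : (PE 0 ∅).ncard = 1 := by
  rw [Set.ncard_eq_one]
  refine ⟨1, ?_⟩
  ext σ
  simp only [PE, Set.mem_ofPred_eq, Set.mem_singleton_iff]
  constructor
  · rintro ⟨h, -⟩
    ext i
    exact h i (by simp)
  · rintro rfl; simp

theorem PE_top (n : ℕ) (E : Finset ℕ) (h : n ∈ E) : (PE n E).ncard = 0 := by
  have : PE n E = ∅ := by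
    rw [Set.eq_empty_iff_forall_notMem]
    rintro σ ⟨h1, h2⟩
    have h3 : n ∈ {i | i < σ i} := by rw [h2]; exact_mod_cast h
    simp only [Set.mem_ofPred_eq] at h3
    by_cases hn : n ∈ Set.Icc 1 n
    · have := (PE_bound h1 hn).2; omega
    · rw [h1 n hn] at h3; omega
  rw [this, Set.ncard_empty]

theorem exc_mul_swap (n : ℕ) (σ : Equiv.Perm ℕ) (h : ∀ i, i ∉ Set.Icc 1 n → σ i = i) (x : ℕ)
    (hx : x ∈ Set.Icc 1 n) :
    {i | i < (σ * Equiv.swap x (n + 1)) i} = insert x {i | i < σ i} := by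
  have hn : σ (n + 1) = n + 1 := h _ (by simp)
  have hb := PE_bound h hx
  ext i
  simp only [Set.mem_ofPred_eq, Set.mem_insert_iff, Equiv.Perm.mul_apply]
  have := hx.2
  have := hb.2
  by_cases h1 : i = x
  · subst h1; rw [Equiv.swap_apply_left, hn]; omega
  · by_cases h2 : i = n + 1
    · subst h2; rw [Equiv.swap_apply_right, hn]; omega
    · rw [Equiv.swap_apply_of_ne_of_ne h1 h2]; simp [h1]

theorem PE_succ (n : ℕ) (E : Finset ℕ) :
    (PE (n + 1) E).ncard = (PE n E).ncard
      + ∑ y ∈ Finset.Icc 1 n with y ∈ E, ((PE n E).ncard + (PE n (E.erase y)).ncard) := by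
  have hU : PE (n + 1) E = ⋃ x ∈ Finset.Icc 1 (n + 1), {σ ∈ PE (n + 1) E | σ x = n + 1} := by
    ext σ
    simp only [Set.mem_iUnion, Set.mem_ofPred_eq, exists_prop, Set.mem_sep_iff]
    constructor
    · intro h
      refine ⟨σ.symm (n + 1), ?_, h, by simp⟩
      rw [Finset.mem_Icc]
      by_contra hn
      have h1 := h.1 _ hn
      simp at h1
      rw [← h1] at hn; simp at hn
    · rintro ⟨_, _, h, _⟩; exact h
  rw [hU, ncard_biUnion]
  rotate_left
  · intro i _; exact (PE_finite _ _).subset (fun σ h => h.1)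
  · intro i _ j _ hij
    rw [Set.disjoint_left]
    rintro σ ⟨_, h1⟩ ⟨_, h2⟩
    exact hij (σ.injective (h1.trans h2.symm))
  rw [← Finset.insert_Icc_right_eq_Icc_add_one (by omega), Finset.sum_insert (by simp)]
  congr 1
  · congr 1
    ext σ
    constructor
    · rintro ⟨⟨h1, h2⟩, h3⟩
      refine ⟨fun i hi => ?_, h2⟩
      by_cases h : i = n + 1
      · rw [h, h3]
      · apply h1; intro h'; apply hi; simp at h' ⊢; omega
    · rintro ⟨h1, h2⟩
      refine ⟨⟨fun i hi => h1 i ?_, h2⟩, h1 _ (by simp)⟩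
      intro h'; apply hi; simp at h' ⊢; omega
  · rw [Finset.sum_filter]
    apply Finset.sum_congr rfl
    intro x hx
    have hx' : x ∈ Set.Icc 1 n := by simpa using hx
    have himg : {σ ∈ PE (n + 1) E | σ x = n + 1}.ncard
        = {τ : Equiv.Perm ℕ | (∀ i, i ∉ Set.Icc 1 n → τ i = i) ∧
            insert x {i | i < τ i} = (E : Set ℕ)}.ncard := by
      apply Set.ncard_congr (fun σ _ => σ * Equiv.swap x (n + 1))
      · rintro σ ⟨⟨h1, h2⟩, h3⟩
        have hfix : ∀ i, i ∉ Set.Icc 1 n → (σ * Equiv.swap x (n + 1)) i = i := by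
          intro i hi
          rw [Equiv.Perm.mul_apply]
          by_cases h : i = n + 1
          · rw [h, Equiv.swap_apply_right, h3]
          · rw [Equiv.swap_apply_of_ne_of_ne (by rintro rfl; exact hi hx') h]
            apply h1; intro h'; apply hi; simp at h' ⊢; omega
        refine ⟨hfix, ?_⟩
        rw [← exc_mul_swap n _ hfix x hx', ← h2, mul_assoc, Equiv.swap_mul_self, mul_one]
      · intro σ τ _ _ h; exact mul_right_cancel h
      · rintro τ ⟨h1, h2⟩
        refine ⟨τ * Equiv.swap x (n + 1), ⟨⟨fun i hi => ?_, ?_⟩, ?_⟩, ?_⟩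
        · rw [Equiv.Perm.mul_apply]
          have a1 : i ≠ x := by rintro rfl; apply hi; simp at hx' ⊢; omega
          have a2 : i ≠ n + 1 := by rintro rfl; apply hi; simp
          rw [Equiv.swap_apply_of_ne_of_ne a1 a2]
          apply h1; intro h'; apply hi; simp at h' ⊢; omega
        · rw [exc_mul_swap n τ h1 x hx', h2]
        · rw [Equiv.Perm.mul_apply, Equiv.swap_apply_left]; exact h1 _ (by simp)
        · rw [mul_assoc, Equiv.swap_mul_self, mul_one]
    rw [himg]
    split_ifs with hxE
    · rw [← Set.ncard_union_eq _ (PE_finite _ _) (PE_finite _ _)]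
      · congr 1
        ext τ
        simp only [PE, Set.mem_ofPred_eq, Set.mem_union, ← and_or_left]
        apply and_congr_right
        intro _
        generalize {i | i < τ i} = S
        constructor
        · intro h
          by_cases hxS : x ∈ S
          · left; rw [← h, Set.insert_eq_of_mem hxS]
          · right; rw [Finset.coe_erase, ← h]; simp [hxS]
        · rintro (h | h)
          · rw [h]; simp [hxE]
          · rw [h]; simp [hxE]
      · rw [Set.disjoint_left]
        rintro τ ⟨_, h1⟩ ⟨_, h2⟩
        rw [h1] at h2
        have : x ∈ (E.erase x : Finset ℕ) := by
          rw [← Finset.mem_coe, ← h2]; exact_mod_cast hxE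
        simp at this
    · have : {τ : Equiv.Perm ℕ | (∀ i, i ∉ Set.Icc 1 n → τ i = i) ∧
            insert x {i | i < τ i} = (E : Set ℕ)} = ∅ := by
        rw [Set.eq_empty_iff_forall_notMem]
        rintro τ ⟨_, h⟩
        apply hxE
        rw [← Finset.mem_coe, ← h]; simp
      rw [this, Set.ncard_empty]

theorem PE_eq_M : ∀ (n : ℕ) (E : Finset ℕ), (∀ e ∈ E, e ∈ Set.Icc 1 n) →
    (PE n E).ncard = M n E (Finset.Icc 1 n) 0 := by
  intro n
  induction n with
  | zero =>
    intro E hE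
    have : E = ∅ := by
      rw [Finset.eq_empty_iff_forall_notMem]
      intro e he; have := hE e he; simp at this
    subst this
    rw [PE_zero]; rfl
  | succ n ih =>
    intro E hE
    by_cases h : n + 1 ∈ E
    · rw [PE_top _ _ h, M_zero (n + 1) E _ 0 (n + 1) (by simp) (by simp) h _ (by omega)]
      intro v hv; simp at hv; omega
    · have hE' : ∀ e ∈ E, e ∈ Set.Icc 1 n := by
        intro e he
        have := hE e he
        have : e ≠ n + 1 := by rintro rfl; exact h he
        simp at *; omega
      rw [PE_succ n E, ← Finset.insert_Icc_right_eq_Icc_add_one (by omega),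
        M_insert n E (Finset.Icc 1 n) 0 (n + 1) (by simp) (by simp) _ (by omega) h, ih E hE']
      · congr 1
        apply Finset.sum_congr rfl
        intro y _
        rw [ih (E.erase y) (fun e he => hE' e (Finset.mem_of_mem_erase he))]
      · intro v hv; simp at hv; omega

theorem perm_card (n : ℕ) (E : Finset ℕ) :
    Nat.card {a : ℕ → ℕ // IsPermOn n a ∧ ExcBottoms n a = (↑E : Set ℕ)} = (PE n E).ncard := by
  rw [show Nat.card {a : ℕ → ℕ // IsPermOn n a ∧ ExcBottoms n a = (↑E : Set ℕ)}
    = {a : ℕ → ℕ | IsPermOn n a ∧ ExcBottoms n a = (↑E : Set ℕ)}.ncard from rfl]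
  symm
  classical
  have hexc : ∀ σ : Equiv.Perm ℕ, (∀ i, i ∉ Set.Icc 1 n → σ i = i) →
      ExcBottoms n (fun i => if i ∈ Set.Icc 1 n then σ i else 0) = {i | i < σ i} := by
    intro σ h
    ext i
    simp only [ExcBottoms, Set.mem_ofPred_eq]
    by_cases hi : i ∈ Set.Icc 1 n
    · simp only [hi, if_true]; exact ⟨fun h => h.2.2, fun h => ⟨hi.1, hi.2, h⟩⟩
    · simp only [hi, if_false, h i hi]; simp
  apply Set.ncard_congr (fun σ _ => fun i => if i ∈ Set.Icc 1 n then σ i else 0)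
  · rintro σ ⟨h1, h2⟩
    refine ⟨⟨⟨?_, ?_, ?_⟩, ?_⟩, ?_⟩
    · intro i hi
      simp only [hi, if_true]
      exact PE_bound h1 hi
    · intro i hi j hj hij
      simp only [hi, hj, if_true] at hij
      exact σ.injective hij
    · intro j hj
      have hs : σ.symm j ∈ Set.Icc 1 n := by
        by_contra h
        have h3 := h1 _ h
        rw [Equiv.apply_symm_apply] at h3
        rw [← h3] at h; exact h hj
      refine ⟨σ.symm j, hs, ?_⟩
      simp only [hs, if_true, Equiv.apply_symm_apply]
    · intro i hi; simp only [hi, if_false]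
    · rw [hexc σ h1, h2]
  · intro σ τ hσ hτ h
    ext i
    by_cases hi : i ∈ Set.Icc 1 n
    · have := congrFun h i
      simpa only [hi, if_true] using this
    · rw [hσ.1 i hi, hτ.1 i hi]
  · rintro a ⟨⟨⟨m1, m2, m3⟩, h2⟩, h3⟩
    let f : ℕ → ℕ := fun i => if i ∈ Set.Icc 1 n then a i else i
    have f1 : ∀ i, i ∈ Set.Icc 1 n → f i = a i := fun i hi => by simp only [f, hi, if_true]
    have f2 : ∀ i, i ∉ Set.Icc 1 n → f i = i := fun i hi => by simp only [f, hi, if_false]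
    have hf : Function.Bijective f := by
      constructor
      · intro i j hij
        by_cases hi : i ∈ Set.Icc 1 n <;> by_cases hj : j ∈ Set.Icc 1 n
        · rw [f1 i hi, f1 j hj] at hij; exact m2 hi hj hij
        · rw [f1 i hi, f2 j hj] at hij; exact absurd (hij ▸ m1 hi) hj
        · rw [f2 i hi, f1 j hj] at hij; exact absurd (hij ▸ m1 hj) hi
        · rw [f2 i hi, f2 j hj] at hij; exact hij
      · intro j
        by_cases hj : j ∈ Set.Icc 1 n
        · obtain ⟨i, hi, rfl⟩ := m3 hj
          exact ⟨i, f1 i hi⟩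
        · exact ⟨j, f2 j hj⟩
    have hfix : ∀ i, i ∉ Set.Icc 1 n → (Equiv.ofBijective f hf) i = i := f2
    have heq : (fun i => if i ∈ Set.Icc 1 n then (Equiv.ofBijective f hf) i else 0) = a := by
      funext i
      by_cases hi : i ∈ Set.Icc 1 n
      · simp only [hi, if_true]; exact f1 i hi
      · simp only [hi, if_false]; exact (h2 i hi).symm
    refine ⟨Equiv.ofBijective f hf, ⟨hfix, ?_⟩, heq⟩
    rw [← hexc _ hfix, heq, h3]

end EWProof
namespace EWProof

theorem tableau_card (F : FerrersShape) (n : ℕ) (R : Finset ℕ) (I J ρ γ : ℕ → ℕ)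
    (h0 : 0 ∈ R) (hI0 : I 0 = 0) (hRn : ∀ r ∈ R, r ≤ n)
    (hρ : ∀ i, i < F.r → ρ i ∈ R ∧ I (ρ i) = i)
    (hI : ∀ r ∈ R, I r < F.r ∧ ρ (I r) = r)
    (hγ : ∀ j, j < F.len 0 → γ j ∉ R ∧ γ j ≤ n ∧ J (γ j) = j)
    (hJ : ∀ c, c ∉ R → c ≤ n → J c < F.len 0 ∧ γ (J c) = c)
    (hadj : ∀ r c, r ∈ R → c ∉ R → c ≤ n → (r < c ↔ J c < F.len (I r))) :
    Nat.card (EWTableau F) = (OR R (Finset.range (n + 1)) 0).ncard := by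
  classical
  have hAdjI : ∀ r c, Adj R (Finset.range (n + 1)) r c → I r < F.r ∧ J c < F.len (I r) := by
    rintro r c ⟨h1, h2, h3, h4, h5⟩
    rw [Finset.mem_range] at h2
    exact ⟨(hI r h3).1, (hadj r c h3 h4 (by omega)).1 h5⟩
  have hlen : ∀ i j, i < F.r → j < F.len i → j < F.len 0 := fun i j hi hj =>
    lt_of_lt_of_le hj (F.anti 0 i (Nat.zero_le _) hi)
  have hAdjρ : ∀ i j, i < F.r → j < F.len i → Adj R (Finset.range (n + 1)) (ρ i) (γ j) := by
    intro i j hi hj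
    obtain ⟨a1, a2⟩ := hρ i hi
    obtain ⟨b1, b2, b3⟩ := hγ j (hlen i j hi hj)
    have := hRn _ a1
    refine ⟨by simp; omega, by simp; omega, a1, b1, ?_⟩
    rw [hadj _ _ a1 b1 b2, a2, b3]; exact hj
  have hρ0 : ρ 0 = 0 := by rw [← hI0]; exact (hI 0 h0).2.trans hI0.symm
  let g : EWTableau F → ℕ → ℕ → Bool := fun t r c =>
    if Adj R (Finset.range (n + 1)) r c then t.one (I r) (J c) else false
  have hg : ∀ t r c, Adj R (Finset.range (n + 1)) r c → g t r c = t.one (I r) (J c) := by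
    intro t r c h; simp only [g, h, if_true]
  have hmem : ∀ t, g t ∈ OR R (Finset.range (n + 1)) 0 := by
    intro t
    have h00 : ∀ c, Adj R (Finset.range (n + 1)) 0 c → g t 0 c = true := by
      intro c h
      rw [hg t 0 c h, hI0]
      apply t.top_row
      have := (hAdjI 0 c h).2
      rwa [hI0] at this
    refine ⟨?_, ?_, ?_, ?_⟩
    · intro r c h
      by_contra hn
      simp [g, hn] at h
    · intro r r' c c' h1 h2 h3 h4 e1 e2 e3 e4
      rw [hg t _ _ h1] at e1
      rw [hg t _ _ h3] at e2
      rw [hg t _ _ h4] at e3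
      rw [hg t _ _ h2] at e4
      have hr : I r ≠ I r' := by intro h; rw [h] at e1; simp_all
      have hc : J c ≠ J c' := by intro h; rw [h] at e1; simp_all
      rcases lt_or_gt_of_ne hr with hr | hr <;> rcases lt_or_gt_of_ne hc with hc | hc
      · exact t.no_rect _ _ _ _ hr (hAdjI _ _ h3).1 hc (hAdjI _ _ h4).2 (by simp [e1, e2, e3, e4])
      · exact t.no_rect _ _ _ _ hr (hAdjI _ _ h3).1 hc (hAdjI _ _ h3).2 (by simp [e1, e2, e3, e4])
      · exact t.no_rect _ _ _ _ hr (hAdjI _ _ h1).1 hc (hAdjI _ _ h2).2 (by simp [e1, e2, e3, e4])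
      · exact t.no_rect _ _ _ _ hr (hAdjI _ _ h1).1 hc (hAdjI _ _ h1).2 (by simp [e1, e2, e3, e4])
    · exact ⟨by simp, fun w => ⟨h00 w, fun h => absurd h.2.2.2.2 (by omega)⟩⟩
    · intro v hv hv0
      exfalso
      have hvn := hv.1
      rw [Finset.mem_range] at hvn
      by_cases hvR : v ∈ R
      · obtain ⟨i1, i2⟩ := hI v hvR
        have hpos : 0 < I v := by
          rcases Nat.eq_zero_or_pos (I v) with h | h
          · rw [h, hρ0] at i2; exact absurd i2.symm hv0
          · exact h
        obtain ⟨j, hj, hz⟩ := t.has_zero (I v) hpos i1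
        have ha := hAdjρ (I v) j i1 hj
        rw [i2] at ha
        have := (hv.2 _).1 ha
        rw [hg t _ _ ha, (hγ j (hlen _ j i1 hj)).2.2, hz] at this
        simp at this
      · have ha : Adj R (Finset.range (n + 1)) 0 v := ⟨by simp, hv.1, h0, hvR, by omega⟩
        have h1 := (hv.2 0).2 ha
        rw [h00 v ha] at h1; simp at h1
  rw [show (OR R (Finset.range (n + 1)) 0).ncard = Nat.card (OR R (Finset.range (n + 1)) 0) from rfl]
  apply Nat.card_eq_of_bijective (fun t => (⟨g t, hmem t⟩ : OR R (Finset.range (n + 1)) 0))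
  constructor
  · intro t t' h
    have h : g t = g t' := congrArg Subtype.val h
    have hone : t.one = t'.one := by
      funext i j
      by_cases hij : i < F.r ∧ j < F.len i
      · have ha := hAdjρ i j hij.1 hij.2
        have h1 := congrFun (congrFun h (ρ i)) (γ j)
        rw [hg _ _ _ ha, hg _ _ _ ha, (hρ i hij.1).2, (hγ j (hlen i j hij.1 hij.2)).2.2] at h1
        exact h1
      · have a1 : t.one i j = false := by
          by_contra h'; exact hij (t.support i j (by simpa using h'))
        have a2 : t'.one i j = false := by
          by_contra h'; exact hij (t'.support i j (by simpa using h'))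
        rw [a1, a2]
    cases t; cases t'; simp at hone; subst hone; rfl
  · rintro ⟨o, hs, hN, hx, hu⟩
    let w : ℕ → ℕ → Bool := fun i j => if i < F.r ∧ j < F.len i then o (ρ i) (γ j) else false
    have hw : ∀ i j, i < F.r → j < F.len i → w i j = o (ρ i) (γ j) := by
      intro i j h1 h2; simp [w, h1, h2]
    let t : EWTableau F :=
      { one := w
        support := by
          intro i j h
          by_contra hn
          simp [w, hn] at h
        top_row := by
          intro j hj
          have ha := hAdjρ 0 j F.r_pos hj
          rw [hw 0 j F.r_pos hj]
          rw [hρ0] at ha ⊢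
          exact (hx.2 _).1 ha
        has_zero := by
          intro i hi hir
          by_contra hcon
          push Not at hcon
          obtain ⟨a1, a2⟩ := hρ i hir
          have hne : ρ i ≠ 0 := by
            intro h; rw [h, hI0] at a2; omega
          have hsink : IsSink R (Finset.range (n + 1)) o (ρ i) := by
            refine ⟨by have := hRn _ a1; simp; omega, fun c => ⟨fun h => ?_, fun h => absurd a1 h.2.2.2.1⟩⟩
            have h1 := (hAdjI _ _ h).2
            rw [a2] at h1
            have h2 := hcon (J c) h1
            rw [hw _ _ hir h1, (hJ c h.2.2.2.1 (by have := h.2.1; simp at this; omega)).2] at h2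
            simpa using h2
          have h1 := (hu _ hsink hne).2
          unfold Compat at h1
          rcases h1 with h1 | h1
          · omega
          · exact h1.1 a1
        no_rect := by
          intro i i' j j' hi hi' hj hj'
          have hir : i < F.r := by omega
          have hle := F.anti i i' hi.le hi'
          rw [hw i j hir (by omega), hw i j' hir (by omega), hw i' j hi' (by omega), hw i' j' hi' hj']
          rintro ⟨e1, e2, e3⟩
          have A1 := hAdjρ i j hir (by omega)
          have A2 := hAdjρ i j' hir (by omega)
          have A3 := hAdjρ i' j hi' (by omega)
          have A4 := hAdjρ i' j' hi' (by omega)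
          cases h1 : o (ρ i) (γ j) <;> cases h2 : o (ρ i) (γ j')
          · simp_all
          · exact hN _ _ _ _ A2 A1 A4 A3 h2 (by rw [← e1, h1]) (by rw [← e2, h2]) h1
          · exact hN _ _ _ _ A1 A2 A3 A4 h1 (by rw [← e2, h2]) (by rw [← e1, h1]) h2
          · simp_all }
    refine ⟨t, ?_⟩
    apply Subtype.ext
    funext r c
    show g t r c = o r c
    by_cases ha : Adj R (Finset.range (n + 1)) r c
    · rw [hg t r c ha]
      show w (I r) (J c) = o r c
      have h1 := hAdjI r c ha
      rw [hw _ _ h1.1 h1.2, (hI r ha.2.2.1).2,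
        (hJ c ha.2.2.2.1 (by have := ha.2.1; simp at this; omega)).2]
    · have : o r c = false := by
        by_contra h'; exact ha (hs r c (by simpa using h'))
      rw [this]; simp [g, ha]

theorem sigma_card (c : FerrersShape → Prop) (F : FerrersShape) (hF : c F)
    (hu : ∀ F', c F' → F' = F) :
    Nat.card {T : Σ F : FerrersShape, EWTableau F // c T.1} = Nat.card (EWTableau F) := by
  symm
  apply Nat.card_eq_of_bijective
    (fun t => (⟨⟨F, t⟩, hF⟩ : {T : Σ F : FerrersShape, EWTableau F // c T.1}))
  constructor
  · intro t t' h
    simpa using h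
  · rintro ⟨⟨F', t⟩, h⟩
    obtain rfl := hu F' h
    exact ⟨t, rfl⟩

theorem count_add (R : Finset ℕ) (m : ℕ) :
    Nat.count (· ∈ R) m + Nat.count (· ∉ R) m = m := by
  induction m with
  | zero => simp
  | succ m ih =>
    rw [Nat.count_succ, Nat.count_succ]
    by_cases h : m ∈ R <;> simp [h] <;> omega

theorem rowLabel_lt (F : FerrersShape) {i j : ℕ} (h : i < j) (hj : j < F.r) :
    rowLabel F i < rowLabel F j := by
  have := F.anti i j h.le hj
  unfold rowLabel; omega

theorem shape_facts (F : FerrersShape) (R : Finset ℕ)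
    (h : {x | ∃ i, i < F.r ∧ rowLabel F i = x} = (R : Set ℕ)) :
    F.r = R.card ∧ ∀ i, i < F.r → Nat.nth (· ∈ R) i = rowLabel F i := by
  have hR : ∀ x, x ∈ R ↔ ∃ i, i < F.r ∧ rowLabel F i = x := by
    intro x; rw [← Finset.mem_coe, ← h]; rfl
  have hinj : ∀ i j, i < F.r → j < F.r → rowLabel F i = rowLabel F j → i = j := by
    intro i j hi hj he
    rcases lt_trichotomy i j with hl | hl | hl
    · have := rowLabel_lt F hl hj; omega
    · exact hl
    · have := rowLabel_lt F hl hi; omega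
  constructor
  · have : R = (Finset.range F.r).image (rowLabel F) := by
      ext x; rw [hR]; simp
    rw [this, Finset.card_image_of_injOn, Finset.card_range]
    intro i hi j hj he
    exact hinj i j (by simpa using hi) (by simpa using hj) he
  · intro i hi
    have hc : Nat.count (· ∈ R) (rowLabel F i) = i := by
      rw [Nat.count_eq_card_filter_range]
      have : (Finset.range (rowLabel F i)).filter (· ∈ R) = (Finset.range i).image (rowLabel F) := by
        ext x
        simp only [Finset.mem_filter, Finset.mem_range, Finset.mem_image, hR]
        constructor
        · rintro ⟨h1, j, hj, rfl⟩
          refine ⟨j, ?_, rfl⟩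
          by_contra hn
          rcases Nat.eq_or_lt_of_le (not_lt.1 hn) with hl | hl
          · subst hl; omega
          · have := rowLabel_lt F hl hj; omega
        · rintro ⟨j, hj, rfl⟩
          exact ⟨rowLabel_lt F hj hi, j, by omega, rfl⟩
      rw [this, Finset.card_image_of_injOn, Finset.card_range]
      intro a ha b hb he
      simp at ha hb
      exact hinj a b (by omega) (by omega) he
    have := Nat.nth_count (p := (· ∈ R)) ((hR _).2 ⟨i, hi, rfl⟩)
    rw [hc] at this
    exact this

theorem shape_unique (n : ℕ) (R : Finset ℕ) (F F' : FerrersShape)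
    (h1 : F.r + F.len 0 = n + 1) (h1' : F'.r + F'.len 0 = n + 1)
    (h : {x | ∃ i, i < F.r ∧ rowLabel F i = x} = (R : Set ℕ))
    (h' : {x | ∃ i, i < F'.r ∧ rowLabel F' i = x} = (R : Set ℕ)) : F = F' := by
  obtain ⟨a, b⟩ := shape_facts F R h
  obtain ⟨a', b'⟩ := shape_facts F' R h'
  have hr : F.r = F'.r := by omega
  have hl : F.len = F'.len := by
    funext i
    by_cases hi : i < F.r
    · have e1 := b i hi
      have e2 := b' i (by omega)
      have c1 := F.anti 0 i (by omega) hi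
      have c2 := F'.anti 0 i (by omega) (by omega)
      unfold rowLabel at e1 e2
      omega
    · rw [F.len_zero i (by omega), F'.len_zero i (by omega)]
  cases F; cases F'
  simp at hr hl
  subst hr; subst hl; rfl

theorem tab_side (n : ℕ) (hn : 0 < n) (R : Finset ℕ) (h0 : 0 ∈ R) (hR : ∀ r ∈ R, r < n) :
    Nat.card {T : Σ F : FerrersShape, EWTableau F //
        T.1.r + T.1.len 0 = n + 1 ∧
        {x | ∃ i, i < T.1.r ∧ rowLabel T.1 i = x} = (↑R : Set ℕ)}
      = (OR R (Finset.range (n + 1)) 0).ncard := by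
  have hpfin : (Set.ofPred (· ∈ R)).Finite := R.finite_toSet
  have hqinf : (Set.ofPred (· ∉ R)).Infinite := hpfin.infinite_compl
  have hcardp : hpfin.toFinset.card = R.card := by
    congr 1; ext x; simp
  have cp : ∀ m, n ≤ m → Nat.count (· ∈ R) m = R.card := by
    intro m hm
    rw [Nat.count_eq_card_filter_range]
    congr 1
    ext x
    simp only [Finset.mem_filter, Finset.mem_range]
    exact ⟨fun h => h.2, fun h => ⟨by have := hR x h; omega, h⟩⟩
  have cqn : R.card + Nat.count (· ∉ R) n = n := by rw [← cp n le_rfl]; exact count_add R n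
  have cqn1 : R.card + Nat.count (· ∉ R) (n + 1) = n + 1 := by
    rw [← cp (n + 1) (by omega)]; exact count_add R _
  have ρmem : ∀ i, i < R.card → Nat.nth (· ∈ R) i ∈ R := by
    intro i hi
    exact Nat.nth_mem (p := (· ∈ R)) i (fun hf => by rw [← hcardp] at hi; exact hi)
  have ρcount : ∀ i, i < R.card → Nat.count (· ∈ R) (Nat.nth (· ∈ R) i) = i := by
    intro i hi
    exact Nat.count_nth (p := (· ∈ R)) (fun hf => by rw [← hcardp] at hi; exact hi)
  have Icard : ∀ r ∈ R, Nat.count (· ∈ R) r < R.card := by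
    intro r hr
    rw [← cp n le_rfl]
    exact Nat.count_strict_mono hr (hR r hr)
  have γmem : ∀ m, Nat.nth (· ∉ R) m ∉ R := fun m => Nat.nth_mem_of_infinite hqinf m
  have γcount : ∀ m, Nat.count (· ∉ R) (Nat.nth (· ∉ R) m) = m :=
    fun m => Nat.count_nth_of_infinite hqinf m
  have qmono : Monotone (Nat.count (· ∉ R)) := Nat.count_monotone _
  have ρ0 : Nat.nth (· ∈ R) 0 = 0 := Nat.nth_zero_of_zero h0
  have hpos : 0 < R.card := Finset.card_pos.2 ⟨0, h0⟩
  have hq : ∀ i, i < R.card → Nat.count (· ∉ R) (Nat.nth (· ∈ R) i) ≤ n - R.card := by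
    intro i hi
    have := qmono (hR _ (ρmem i hi)).le
    omega
  let F : FerrersShape :=
    { r := R.card
      len := fun i => if i < R.card then n + 1 - R.card - Nat.count (· ∉ R) (Nat.nth (· ∈ R) i) else 0
      r_pos := hpos
      anti := by
        intro i j hij hj
        have hi : i < R.card := by omega
        have h1 : Nat.nth (· ∈ R) i ≤ Nat.nth (· ∈ R) j :=
          Nat.nth_le_nth' (p := (· ∈ R)) hij (fun hf => by rw [← hcardp] at hj; exact hj)
        have := qmono h1
        simp only [hi, hj, if_true]
        omega
      len_pos := by
        intro i hi
        have := hq i hi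
        simp only [hi, if_true]
        omega
      len_zero := by
        intro i hi
        simp [not_lt.2 hi] }
  have Fr : F.r = R.card := rfl
  have Flen : ∀ i, i < R.card → F.len i = n + 1 - R.card - Nat.count (· ∉ R) (Nat.nth (· ∈ R) i) := by
    intro i hi
    show (if i < R.card then _ else _) = _
    rw [if_pos hi]
  have F0 : F.len 0 = n + 1 - R.card := by rw [Flen 0 hpos, ρ0]; simp
  have Flab : ∀ i, i < R.card → rowLabel F i = Nat.nth (· ∈ R) i := by
    intro i hi
    have h1 := hq i hi
    have h2 := count_add R (Nat.nth (· ∈ R) i)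
    rw [ρcount i hi] at h2
    unfold rowLabel
    rw [F0, Flen i hi]; omega
  have Fc1 : F.r + F.len 0 = n + 1 := by rw [F0, Fr]; omega
  have Fc2 : {x | ∃ i, i < F.r ∧ rowLabel F i = x} = (↑R : Set ℕ) := by
    ext x
    simp only [Set.mem_ofPred_eq, Finset.mem_coe]
    constructor
    · rintro ⟨i, hi, rfl⟩; rw [Flab i hi]; exact ρmem i hi
    · intro hx
      refine ⟨Nat.count (· ∈ R) x, Icard x hx, ?_⟩
      rw [Flab _ (Icard x hx)]
      exact Nat.nth_count (p := (· ∈ R)) hx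
  rw [sigma_card (fun F => F.r + F.len 0 = n + 1 ∧
        {x | ∃ i, i < F.r ∧ rowLabel F i = x} = (↑R : Set ℕ)) F ⟨Fc1, Fc2⟩
        (fun F' h => shape_unique n R F' F h.1 Fc1 h.2 Fc2)]
  have qlt : ∀ c, c ∉ R → c ≤ n → Nat.count (· ∉ R) c < n + 1 - R.card := by
    intro c hc hcn
    have := Nat.count_strict_mono (p := (· ∉ R)) hc (show c < n + 1 by omega)
    omega
  apply tableau_card F n R (Nat.count (· ∈ R)) (fun c => n + 1 - R.card - 1 - Nat.count (· ∉ R) c)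
    (Nat.nth (· ∈ R)) (fun j => Nat.nth (· ∉ R) (n + 1 - R.card - 1 - j)) h0 (by simp)
    (fun r hr => (hR r hr).le)
  · intro i hi; exact ⟨ρmem i hi, ρcount i hi⟩
  · intro r hr; exact ⟨Icard r hr, Nat.nth_count (p := (· ∈ R)) hr⟩
  · intro j hj
    rw [F0] at hj
    refine ⟨γmem _, ?_, ?_⟩
    · have := Nat.nth_lt_of_lt_count (p := (· ∉ R)) (k := n + 1 - R.card - 1 - j) (n := n + 1) (by omega)
      omega
    · simp only [γcount]; omega
  · intro c hc hcn
    have := qlt c hc hcn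
    refine ⟨by rw [F0]; omega, ?_⟩
    show Nat.nth _ (n + 1 - R.card - 1 - (n + 1 - R.card - 1 - Nat.count (· ∉ R) c)) = c
    rw [show n + 1 - R.card - 1 - (n + 1 - R.card - 1 - Nat.count (· ∉ R) c) = Nat.count (· ∉ R) c by omega]
    exact Nat.nth_count (p := (· ∉ R)) hc
  · intro r c hr hc hcn
    rw [Flen _ (Icard r hr), Nat.nth_count (p := (· ∈ R)) hr]
    have h1 := qlt c hc hcn
    constructor
    · intro h
      have := qmono h.le
      omega
    · intro h
      by_contra hn
      have hne : c ≠ r := by rintro rfl; exact hc hr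
      have := Nat.count_strict_mono (p := (· ∉ R)) hc (show c < r by omega)
      omega

end EWProof
/-- for every `n ≥ 1` and every `E = {e_1,…,e_k} ⊆ {1,…,n-1}`, the
number of EW-tableaux of size `n` (i.e. rows + columns = n + 1) whose set of row
labels is `{0} ∪ E` equals the number of `n`-permutations whose excedance bottoms
set is `E`. -/
theorem ewTableaux_card_eq_excedance_card (n : ℕ) (hn : 0 < n)
    (E : Finset ℕ) (hE : ∀ e ∈ E, 1 ≤ e ∧ e ≤ n - 1) :
    Nat.card {T : Σ F : FerrersShape, EWTableau F //
        T.1.r + T.1.len 0 = n + 1 ∧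
        {x | ∃ i, i < T.1.r ∧ rowLabel T.1 i = x} = insert 0 (↑E : Set ℕ)}
      = Nat.card {a : ℕ → ℕ // IsPermOn n a ∧ ExcBottoms n a = (↑E : Set ℕ)} := by
  have hR : ∀ r ∈ insert 0 E, r < n := by
    intro r hr
    rcases Finset.mem_insert.1 hr with h | h
    · omega
    · have := hE r h; omega
  have h1 := EWProof.tab_side n hn (insert 0 E) (Finset.mem_insert_self _ _) hR
  rw [Finset.coe_insert] at h1
  rw [h1, EWProof.perm_card, EWProof.PE_eq_M n E (fun e he => by have := hE e he; simp; omega)]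
  have h2 : Finset.range (n + 1) = insert 0 (Finset.Icc 1 n) := by
    ext x; simp; omega
  rw [h2, EWProof.OR_ncard (insert 0 E) n (Finset.Icc 1 n) 0 (by simp) (by simp)]
  apply EWProof.M_congr
  intro v hv
  rw [Finset.mem_Icc] at hv
  rw [Finset.mem_insert]
  constructor
  · rintro (h | h)
    · omega
    · exact h
  · exact Or.inr
end

section
/- For all positive integers n and all k ≥ 0, the number of EW-tableaux of size n having exactly k columns all of whose cells contain 1 equals the number of n-permutations with exactly k fixed points. -/
structure Ori (n : ℕ) (C : ℕ → Prop) (E : ℕ → ℕ → Prop) : Prop where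
  edge : ∀ a b, E a b → (¬ C a ∧ C b ∧ a < b) ∨ (C a ∧ ¬ C b ∧ b < a)
  tot : ∀ a b, a < b → b ≤ n → ¬ C a → C b → E a b ∨ E b a
  asym : ∀ a b, E a b → ¬ E b a
  cyc : ∀ a b c d, E a b → E b c → E c d → E d a → False
  zero : ¬ C 0
  zrow : ∀ b, C b → b ≤ n → E 0 b
  row : ∀ a, ¬ C a → 0 < a → a ≤ n → ∃ b, b ≤ n ∧ E b a

def Src (E : ℕ → ℕ → Prop) (U : Finset ℕ) (s : ℕ) : Prop := s ∈ U ∧ ∀ x ∈ U, ¬ E x s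

theorem Ori.exists_src {n : ℕ} {C : ℕ → Prop} {E : ℕ → ℕ → Prop} (h : Ori n C E) :
    ∀ (m : ℕ) (U : Finset ℕ), U.card = m → (∀ x ∈ U, x ≤ n) → U.Nonempty → ∃ s, Src E U s := by
  intro m
  induction m with
  | zero =>
    intro U hc _ hne
    rw [Finset.card_eq_zero] at hc
    simp [hc] at hne
  | succ m ih =>
    intro U hc hn hne
    by_contra hno
    have hno' : ∀ s ∈ U, ∃ x ∈ U, E x s := by
      intro s hs
      by_contra h2
      push Not at h2
      exact hno ⟨s, hs, h2⟩
    have hmU := U.max'_mem hne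
    have hmax : ∀ x ∈ U, x ≤ U.max' hne := fun x hx => U.le_max' x hx
    generalize U.max' hne = M at hmU hmax
    have key : ∀ t ∈ U, (U.erase t).Nonempty → ∃ s, s ∈ U ∧ s ≠ t ∧ E t s ∧
        ∀ x ∈ U, x ≠ t → ¬ E x s := by
      intro t ht hne'
      obtain ⟨s, hs, hs'⟩ := ih (U.erase t) (by rw [Finset.card_erase_of_mem ht]; omega)
        (fun x hx => hn x (Finset.mem_of_mem_erase hx)) hne'
      rw [Finset.mem_erase] at hs
      have hs2 : ∀ x ∈ U, x ≠ t → ¬ E x s := fun x hx hxt => hs' x (Finset.mem_erase.2 ⟨hxt, hx⟩)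
      refine ⟨s, hs.2, hs.1, ?_, hs2⟩
      obtain ⟨x, hx, hxs⟩ := hno' s hs.2
      by_cases hxt : x = t
      · rwa [hxt] at hxs
      · exact absurd hxs (hs2 x hx hxt)
    obtain ⟨r, hr, hrM⟩ := hno' M hmU
    have hrM' := h.edge _ _ hrM
    have hrle := hmax r hr
    have hrr : ¬ C r ∧ C M ∧ r < M := by
      rcases hrM' with h1 | h1
      · exact h1
      · omega
    obtain ⟨s, hsU, hsM, hMs, hs⟩ := key M hmU ⟨r, Finset.mem_erase.2 ⟨by omega, hr⟩⟩
    have hss : ¬ C s := by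
      rcases h.edge _ _ hMs with h1 | h1
      · exact absurd hrr.2.1 h1.1
      · exact h1.2.1
    obtain ⟨s', hsU', hss', hE', hs'⟩ := key s hsU ⟨M, Finset.mem_erase.2 ⟨hsM.symm, hmU⟩⟩
    have hs'C : C s' ∧ s < s' := by
      rcases h.edge _ _ hE' with h1 | h1
      · exact h1.2
      · exact absurd h1.1 hss
    have hrs : r ≠ s := by
      rintro rfl
      exact h.asym _ _ hrM hMs
    obtain ⟨c, hc, hcr⟩ := hno' r hr
    have hcM : c ≠ M := by
      rintro rfl
      exact h.asym _ _ hrM hcr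
    have hcC : C c ∧ r < c := by
      rcases h.edge _ _ hcr with h1 | h1
      · exact absurd h1.2.1 hrr.1
      · exact ⟨h1.1, h1.2.2⟩
    by_cases hlt : r < s'
    · rcases h.tot r s' hlt (hn _ hsU') hrr.1 hs'C.1 with h1 | h1
      · exact hs' r hr hrs h1
      · exact h.cyc _ _ _ _ h1 hrM hMs hE'
    · rcases h.tot s c (by omega) (hn _ hc) hss hcC.1 with h1 | h1
      · exact h.cyc _ _ _ _ h1 hcr hrM hMs
      · exact hs c hc hcM h1

def EwInv (C : ℕ → Prop) (E : ℕ → ℕ → Prop) (v : ℕ) (U : Finset ℕ) : Prop :=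
  (C v → (∀ s, Src E U s → C s → v < s) ∧
    (∀ s, Src E U s → ¬ C s → s < v ∨ ∃ s', Src E U s' ∧ C s' ∧ s < s')) ∧
  (¬ C v → (∀ s, Src E U s → ¬ C s → s < v) ∧
    (∀ s, Src E U s → C s → v < s ∨ ∃ s', Src E U s' ∧ ¬ C s' ∧ s' < s))

theorem exists_min_nat (P : ℕ → Prop) (h : ∃ x, P x) : ∃ x, P x ∧ ∀ y, P y → x ≤ y := by
  classical
  exact ⟨Nat.find h, Nat.find_spec h, fun y hy => Nat.find_min' h hy⟩

theorem exists_max_nat (P : ℕ → Prop) (n : ℕ) (hb : ∀ x, P x → x ≤ n) (h : ∃ x, P x) :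
    ∃ x, P x ∧ ∀ y, P y → y ≤ x := by
  classical
  obtain ⟨x, hx⟩ := h
  exact ⟨Nat.findGreatest P n, Nat.findGreatest_spec (hb x hx) hx,
    fun y hy => Nat.le_findGreatest (hb y hy) hy⟩

theorem src_erase {E : ℕ → ℕ → Prop} {U : Finset ℕ} {x s : ℕ} (h : Src E (U.erase x) s) :
    s ≠ x ∧ (Src E U s ∨ E x s) := by
  obtain ⟨h1, h2⟩ := h
  rw [Finset.mem_erase] at h1
  refine ⟨h1.1, ?_⟩
  by_cases hx : E x s
  · exact Or.inr hx
  · refine Or.inl ⟨h1.2, fun y hy => ?_⟩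
    by_cases hyx : y = x
    · rwa [hyx]
    · exact h2 y (Finset.mem_erase.2 ⟨hyx, hy⟩)

theorem src_erase' {E : ℕ → ℕ → Prop} {U : Finset ℕ} {x s : ℕ} (h : Src E U s) (hx : s ≠ x) :
    Src E (U.erase x) s :=
  ⟨Finset.mem_erase.2 ⟨hx, h.1⟩, fun y hy => h.2 y (Finset.mem_of_mem_erase hy)⟩

theorem Ori.step {n : ℕ} {C : ℕ → Prop} {E : ℕ → ℕ → Prop} (h : Ori n C E)
    (U : Finset ℕ) (v : ℕ) (hn : ∀ x ∈ U, x ≤ n) (hne : U.Nonempty) (hI : EwInv C E v U) :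
    ∃ x, Src E U x ∧ (C x ↔ v < x) ∧ EwInv C E x (U.erase x) := by
  have hsrc := h.exists_src _ U rfl hn hne
  by_cases hv : C v
  · obtain ⟨ha, hb⟩ := hI.1 hv
    by_cases hcol : ∃ s, Src E U s ∧ C s
    · obtain ⟨x, ⟨hx, hxC⟩, hmin⟩ := exists_min_nat _ hcol
      refine ⟨x, hx, by simp [hxC, ha x hx hxC], fun _ => ⟨?_, ?_⟩, fun h' => absurd hxC h'⟩
      · intro s hs hsC
        obtain ⟨hne, h1 | h1⟩ := src_erase hs
        · have := hmin s ⟨h1, hsC⟩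
          omega
        · rcases h.edge _ _ h1 with h2 | h2
          · exact absurd hxC h2.1
          · exact absurd hsC h2.2.1
      · intro s hs hsC
        obtain ⟨hne, h1 | h1⟩ := src_erase hs
        · obtain h2 | ⟨s', h2, h3, h4⟩ := hb s h1 hsC
          · have := ha x hx hxC
            left; omega
          · by_cases hsx : s' = x
            · left; omega
            · exact Or.inr ⟨s', src_erase' h2 hsx, h3, h4⟩
        · rcases h.edge _ _ h1 with h2 | h2
          · exact absurd hxC h2.1
          · exact Or.inl h2.2.2
    · have hrow : ∃ s, Src E U s ∧ ¬ C s := by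
        obtain ⟨s, hs⟩ := hsrc
        exact ⟨s, hs, fun hc => hcol ⟨s, hs, hc⟩⟩
      obtain ⟨x, ⟨hx, hxC⟩, hmax⟩ := exists_max_nat _ n (fun x hx => hn x hx.1.1) hrow
      have hxv : x < v := by
        obtain h2 | ⟨s', h2, h3, h4⟩ := hb x hx hxC
        · exact h2
        · exact absurd ⟨s', h2, h3⟩ hcol
      refine ⟨x, hx, by simp [hxC, hxv.le], fun h' => absurd h' hxC, fun _ => ⟨?_, ?_⟩⟩
      · intro s hs hsC
        obtain ⟨hne, h1 | h1⟩ := src_erase hs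
        · have := hmax s ⟨h1, hsC⟩
          omega
        · rcases h.edge _ _ h1 with h2 | h2
          · exact absurd h2.2.1 hsC
          · exact absurd h2.1 hxC
      · intro s hs hsC
        obtain ⟨hne, h1 | h1⟩ := src_erase hs
        · exact absurd ⟨s, h1, hsC⟩ hcol
        · rcases h.edge _ _ h1 with h2 | h2
          · exact Or.inl h2.2.2
          · exact absurd h2.1 hxC
  · obtain ⟨ha, hb⟩ := hI.2 hv
    by_cases hrow : ∃ s, Src E U s ∧ ¬ C s
    · obtain ⟨x, ⟨hx, hxC⟩, hmax⟩ := exists_max_nat _ n (fun x hx => hn x hx.1.1) hrow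
      refine ⟨x, hx, by simp [hxC, (ha x hx hxC).le], fun h' => absurd h' hxC, fun _ => ⟨?_, ?_⟩⟩
      · intro s hs hsC
        obtain ⟨hne, h1 | h1⟩ := src_erase hs
        · have := hmax s ⟨h1, hsC⟩
          omega
        · rcases h.edge _ _ h1 with h2 | h2
          · exact absurd h2.2.1 hsC
          · exact absurd h2.1 hxC
      · intro s hs hsC
        obtain ⟨hne, h1 | h1⟩ := src_erase hs
        · obtain h2 | ⟨s', h2, h3, h4⟩ := hb s h1 hsC
          · have := ha x hx hxC
            left; omega
          · by_cases hsx : s' = x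
            · left; omega
            · exact Or.inr ⟨s', src_erase' h2 hsx, h3, h4⟩
        · rcases h.edge _ _ h1 with h2 | h2
          · exact Or.inl h2.2.2
          · exact absurd h2.1 hxC
    · have hcol : ∃ s, Src E U s ∧ C s := by
        obtain ⟨s, hs⟩ := hsrc
        exact ⟨s, hs, by_contra fun hc => hrow ⟨s, hs, hc⟩⟩
      obtain ⟨x, ⟨hx, hxC⟩, hmin⟩ := exists_min_nat _ hcol
      have hxv : v < x := by
        obtain h2 | ⟨s', h2, h3, h4⟩ := hb x hx hxC
        · exact h2
        · exact absurd ⟨s', h2, h3⟩ hrow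
      refine ⟨x, hx, by simp [hxC, hxv], fun _ => ⟨?_, ?_⟩, fun h' => absurd hxC h'⟩
      · intro s hs hsC
        obtain ⟨hne, h1 | h1⟩ := src_erase hs
        · have := hmin s ⟨h1, hsC⟩
          omega
        · rcases h.edge _ _ h1 with h2 | h2
          · exact absurd hxC h2.1
          · exact absurd hsC h2.2.1
      · intro s hs hsC
        obtain ⟨hne, h1 | h1⟩ := src_erase hs
        · exact absurd ⟨s, h1, hsC⟩ hrow
        · rcases h.edge _ _ h1 with h2 | h2
          · exact absurd hxC h2.1
          · exact Or.inl h2.2.2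

def Ch (C : ℕ → Prop) (a b : ℕ) : Prop := C b ↔ a < b
def Pw (E : ℕ → ℕ → Prop) (a b : ℕ) : Prop := ¬ E b a

theorem Ori.greedy {n : ℕ} {C : ℕ → Prop} {E : ℕ → ℕ → Prop} (h : Ori n C E) :
    ∀ (m : ℕ) (U : Finset ℕ) (v : ℕ), U.card = m → (∀ x ∈ U, x ≤ n) → EwInv C E v U →
    ∃ l : List ℕ, l.Nodup ∧ (∀ x, x ∈ l ↔ x ∈ U) ∧ (v :: l).IsChain (Ch C) ∧
      l.Pairwise (Pw E) := by
  intro m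
  induction m with
  | zero =>
    intro U v hc _ _
    rw [Finset.card_eq_zero] at hc
    exact ⟨[], by simp [hc]⟩
  | succ m ih =>
    intro U v hc hn hI
    obtain ⟨x, hx, hxc, hI'⟩ := h.step U v hn (Finset.card_pos.1 (by omega)) hI
    obtain ⟨l, h1, h2, h3, h4⟩ := ih (U.erase x) x (by rw [Finset.card_erase_of_mem hx.1]; omega)
        (fun y hy => hn y (Finset.mem_of_mem_erase hy)) hI'
    refine ⟨x :: l, ?_, ?_, ?_, ?_⟩
    · simp [h1, h2]
    · intro y
      have := hx.1
      by_cases hy : y = x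
      · simp [hy, this]
      · simp [h2, hy]
    · exact List.IsChain.cons_cons hxc h3
    · refine List.Pairwise.cons (fun y hy => ?_) h4
      exact hx.2 y (Finset.mem_of_mem_erase ((h2 y).1 hy))

theorem Ori.exists_word {n : ℕ} {C : ℕ → Prop} {E : ℕ → ℕ → Prop} (h : Ori n C E) :
    ∃ l : List ℕ, l.Nodup ∧ (∀ x, x ∈ l ↔ 1 ≤ x ∧ x ≤ n) ∧ (0 :: l).IsChain (Ch C) ∧
      (0 :: l).Pairwise (Pw E) := by
  obtain ⟨l, h1, h2, h3, h4⟩ := h.greedy _ (Finset.Icc 1 n) 0 rfl (by simp) (by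
    refine ⟨fun h' => absurd h' h.zero, fun _ => ⟨?_, ?_⟩⟩
    · intro s hs hsC
      have h1 := Finset.mem_Icc.1 hs.1
      obtain ⟨b, hb, hE⟩ := h.row s hsC (by omega) h1.2
      refine absurd hE (hs.2 b (Finset.mem_Icc.2 ⟨?_, hb⟩))
      rcases h.edge _ _ hE with h2 | h2
      · exact absurd h2.2.1 hsC
      · omega
    · intro s hs hsC
      have h1 := Finset.mem_Icc.1 hs.1
      left; omega)
  refine ⟨l, h1, by simpa using h2, h3, List.Pairwise.cons (fun y hy => ?_) h4⟩
  have hy' := Finset.mem_Icc.1 ((h2 y).1 hy)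
  intro hE
  rcases h.edge _ _ hE with h2 | h2
  · omega
  · exact h.asym _ _ hE (h.zrow y h2.1 hy'.2)

theorem chain_lem_row {C : ℕ → Prop} {E : ℕ → ℕ → Prop} (x : ℕ) (hx : C x) : ∀ (s : List ℕ) (y : ℕ),
    (y :: s).IsChain (Ch C) → s.Pairwise (Pw E) → x ∈ s → x < y →
    ∃ r ∈ s, r < x ∧ ¬ C r ∧ ¬ E x r := by
  intro s
  induction s with
  | nil => simp
  | cons z zs ih =>
    intro y hch hpw hxs hxy
    rw [List.isChain_cons_cons] at hch
    rw [List.pairwise_cons] at hpw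
    have hc : C z ↔ y < z := hch.1
    by_cases hxz : x = z
    · subst hxz
      have := hc.1 hx
      omega
    · have hxzs : x ∈ zs := by simpa [hxz] using hxs
      by_cases hlt : z < x
      · exact ⟨z, by simp, hlt, by rw [hc]; omega, hpw.1 x hxzs⟩
      · obtain ⟨r, h1, h2⟩ := ih z hch.2 hpw.2 hxzs (by omega)
        exact ⟨r, by simp [h1], h2⟩

theorem chain_lem_col {C : ℕ → Prop} {E : ℕ → ℕ → Prop} (x : ℕ) (hx : ¬ C x) :
    ∀ (s : List ℕ) (y : ℕ),
    (y :: s).IsChain (Ch C) → s.Pairwise (Pw E) → x ∈ s → y < x →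
    ∃ r ∈ s, x < r ∧ C r ∧ ¬ E x r := by
  intro s
  induction s with
  | nil => simp
  | cons z zs ih =>
    intro y hch hpw hxs hxy
    rw [List.isChain_cons_cons] at hch
    rw [List.pairwise_cons] at hpw
    have hc : C z ↔ y < z := hch.1
    by_cases hxz : x = z
    · subst hxz
      exact absurd (hc.2 hxy) hx
    · have hxzs : x ∈ zs := by simpa [hxz] using hxs
      by_cases hlt : x < z
      · exact ⟨z, by simp, hlt, by rw [hc]; omega, hpw.1 x hxzs⟩
      · obtain ⟨r, h1, h2⟩ := ih z hch.2 hpw.2 hxzs (by omega)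
        exact ⟨r, by simp [h1], h2⟩

/-- the key local step for uniqueness -/
theorem Ori.head_aux {n : ℕ} {C : ℕ → Prop} {E : ℕ → ℕ → Prop} (h : Ori n C E)
    {v x y : ℕ} {s s' : List ℕ} (hmem : ∀ z, z ∈ x :: s ↔ z ∈ y :: s')
    (hn : ∀ z ∈ x :: s, z ≤ n)
    (h1 : (v :: x :: s).IsChain (Ch C)) (h2 : (v :: y :: s').IsChain (Ch C))
    (p1 : (x :: s).Pairwise (Pw E)) (p2 : (y :: s').Pairwise (Pw E)) (hxy : x < y) : False := by
  rw [List.isChain_cons_cons] at h1 h2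
  rw [List.pairwise_cons] at p1 p2
  have c1 : C x ↔ v < x := h1.1
  have c2 : C y ↔ v < y := h2.1
  have hx : x ∈ s' := by
    have := (hmem x).1 (by simp)
    rcases List.mem_cons.1 this with h | h
    · omega
    · exact h
  have hy : y ∈ s := by
    have := (hmem y).2 (by simp)
    rcases List.mem_cons.1 this with h | h
    · omega
    · exact h
  have hnx := hn x (by simp)
  have hny := hn y (by simp [hy])
  by_cases hCx : C x
  · -- then `y` is a column as well
    obtain ⟨r, hr, hrx, hrC, hrE⟩ := chain_lem_row (E := E) x hCx s' y h2.2 p2.2 hx hxy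
    have hrs : r ∈ s := by
      have := (hmem r).2 (by simp [hr])
      rcases List.mem_cons.1 this with h | h
      · omega
      · exact h
    rcases h.tot r x hrx hnx hrC hCx with h3 | h3
    · exact p1.1 r hrs h3
    · exact hrE h3
  · by_cases hCy : C y
    · rcases h.tot x y hxy hny hCx hCy with h3 | h3
      · exact p2.1 x hx h3
      · exact p1.1 y hy h3
    · obtain ⟨r, hr, hrx, hrC, hrE⟩ := chain_lem_col (E := E) y hCy s x h1.2 p1.2 hy hxy
      have hrs : r ∈ s' := by
        have := (hmem r).1 (by simp [hr])
        rcases List.mem_cons.1 this with h | h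
        · omega
        · exact h
      rcases h.tot y r hrx (hn r (by simp [hr])) hCy hrC with h3 | h3
      · exact hrE h3
      · exact p2.1 r hrs h3

theorem Ori.unique_word {n : ℕ} {C : ℕ → Prop} {E : ℕ → ℕ → Prop} (h : Ori n C E) :
    ∀ (l l' : List ℕ) (v : ℕ), l.Nodup → l'.Nodup → (∀ z, z ∈ l ↔ z ∈ l') → (∀ z ∈ l, z ≤ n) →
    (v :: l).IsChain (Ch C) → (v :: l').IsChain (Ch C) → l.Pairwise (Pw E) → l'.Pairwise (Pw E) →
    l = l' := by
  intro l
  induction l with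
  | nil =>
    intro l' v _ _ hm _ _ _ _ _
    symm
    rw [List.eq_nil_iff_forall_not_mem]
    intro a ha
    simpa using (hm a).2 ha
  | cons x s ih =>
    intro l' v nd nd' hm hn h1 h2 p1 p2
    cases l' with
    | nil => simpa using (hm x).1 (by simp)
    | cons y s' =>
      have hxy : x = y := by
        rcases lt_trichotomy x y with hlt | heq | hlt
        · exact (h.head_aux hm hn h1 h2 p1 p2 hlt).elim
        · exact heq
        · exact (h.head_aux (fun z => (hm z).symm) (fun z hz => hn z ((hm z).2 hz))
            h2 h1 p2 p1 hlt).elim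
      subst hxy
      rw [List.isChain_cons_cons] at h1 h2
      rw [List.pairwise_cons] at p1 p2
      rw [List.nodup_cons] at nd nd'
      rw [ih s' x nd.2 nd'.2 ?_ (fun z hz => hn z (by simp [hz])) h1.2 h2.2 p1.2 p2.2]
      intro z
      have := hm z
      by_cases hz : z = x
      · subst hz; simp [nd.1, nd'.1]
      · simpa [hz] using this

def stat : ℕ → List ℕ → ℕ
  | _, [] => 0
  | v, c :: l => (if v < c ∧ ∀ d ∈ l, c < d then 1 else 0) + stat c l

theorem stat_le : ∀ (l : List ℕ) (v : ℕ), stat v l ≤ l.length := by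
  intro l
  induction l with
  | nil => simp [stat]
  | cons c l ih =>
    intro v
    have := ih c
    simp only [stat, List.length_cons]
    split_ifs <;> omega

theorem sum_permAux (t : ℕ) : ∀ (l : List ℕ) (v : ℕ) (φ : ℕ → ℕ), v < t → (∀ x ∈ l, x < t) →
    ((List.permutations'Aux t l).map (fun w => φ (stat v w))).sum =
      φ (stat v l + 1) + stat v l * φ (stat v l - 1) + (l.length - stat v l) * φ (stat v l) := by
  intro l
  induction l with
  | nil =>
    intro v φ hv _
    simp [stat, hv]
  | cons y ys ih =>
    intro v φ hv hl
    have hy : y < t := hl y (by simp)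
    have hys : ∀ x ∈ ys, x < t := fun x hx => hl x (by simp [hx])
    simp only [List.permutations'Aux, List.map_cons, List.map_map, List.sum_cons]
    set b := (if v < y ∧ ∀ d ∈ ys, y < d then 1 else 0) with hb
    have e1 : stat v (t :: y :: ys) = stat y ys := by
      have n1 : ¬ (v < t ∧ ∀ d ∈ y :: ys, t < d) := by
        rintro ⟨_, h2⟩
        have := h2 y (by simp)
        omega
      have n2 : ¬ (t < y ∧ ∀ d ∈ ys, y < d) := by
        rintro ⟨h1, _⟩
        omega
      simp only [stat, if_neg n1, if_neg n2]
      omega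
    have e2 : ((List.permutations'Aux t ys).map ((fun w => φ (stat v w)) ∘ List.cons y)) =
        ((List.permutations'Aux t ys).map (fun w => (fun m => φ (b + m)) (stat y w))) := by
      apply List.map_congr_left
      intro w hw
      have hp : w.Perm (t :: ys) := by
        have : w ∈ List.permutations' (t :: ys) := by
          rw [List.permutations', List.mem_flatMap]
          exact ⟨ys, by rw [List.mem_permutations'], hw⟩
        rwa [List.mem_permutations'] at this
      have : (v < y ∧ ∀ d ∈ w, y < d) ↔ (v < y ∧ ∀ d ∈ ys, y < d) := by
        simp [hp.mem_iff, hy]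
      simp only [Function.comp, stat, this, hb]
    have hs : stat v (y :: ys) = b + stat y ys := by simp only [stat, hb]
    have hle := stat_le ys y
    rw [e1, e2, ih y (fun m => φ (b + m)) hy hys, hs, List.length_cons]
    have hb2 : b = 0 ∨ b = 1 := by rw [hb]; split_ifs <;> simp
    generalize stat y ys = s at *
    clear_value b
    obtain ⟨d, hd⟩ := Nat.exists_eq_add_of_le hle
    rw [hd]
    rcases hb2 with rfl | rfl
    · have a1 : s + d - s = d := by omega
      have a2 : s + d + 1 - (0 + s) = d + 1 := by omega
      rw [a1, a2]
      simp only [Nat.zero_add]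
      ring
    · have a1 : s + d - s = d := by omega
      have a2 : s + d + 1 - (1 + s) = d := by omega
      have a3 : 1 + s - 1 = s := by omega
      rw [a1, a2, a3]
      rcases s with _ | s
      · simp; ring
      · have a4 : 1 + (s + 1 - 1) = s + 1 := by omega
        rw [a4]; ring_nf

def LL : ℕ → List ℕ
  | 0 => []
  | n + 1 => (n + 1) :: LL n

theorem mem_LL (n x : ℕ) : x ∈ LL n ↔ 1 ≤ x ∧ x ≤ n := by
  induction n with
  | zero => simp [LL]; omega
  | succ n ih => simp [LL, ih]; omega

theorem nodup_LL (n : ℕ) : (LL n).Nodup := by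
  induction n with
  | zero => simp [LL]
  | succ n ih => simp [LL, ih, mem_LL]

theorem length_LL (n : ℕ) : (LL n).length = n := by
  induction n with
  | zero => simp [LL]
  | succ n ih => simp [LL, ih]

theorem sum_words_succ (n : ℕ) (φ : ℕ → ℕ) :
    ((LL (n + 1)).permutations'.map (fun w => φ (stat 0 w))).sum =
    ((LL n).permutations'.map (fun w => (fun m => φ (m + 1) + m * φ (m - 1) + (n - m) * φ m)
      (stat 0 w))).sum := by
  simp only [LL, List.permutations', List.map_flatMap]
  rw [List.flatMap_def, List.sum_flatten, List.map_map]
  congr 1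
  apply List.map_congr_left
  intro w hw
  rw [List.mem_permutations'] at hw
  simp only [Function.comp]
  rw [sum_permAux (n + 1) w 0 φ (by omega) (by
    intro x hx
    have := (mem_LL n x).1 (hw.mem_iff.1 hx)
    omega), hw.length_eq, length_LL]

open Equiv in
theorem sum_perm_option (α : Type) [Fintype α] [DecidableEq α] (φ : ℕ → ℕ) :
    ∑ σ : Perm (Option α), φ (Finset.univ.filter (fun x => σ x = x)).card =
    ∑ σ : Perm α, (fun m => φ (m + 1) + m * φ (m - 1) + (Fintype.card α - m) * φ m)
      (Finset.univ.filter (fun x => σ x = x)).card := by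
  rw [← Equiv.sum_comp (Equiv.Perm.decomposeOption (α := α)).symm, Fintype.sum_prod_type_right]
  apply Finset.sum_congr rfl
  intro σ _
  rw [Fintype.sum_option]
  set S := Finset.univ.filter (fun x => σ x = x) with hS
  have e0 : (Finset.univ.filter (fun x =>
      (Equiv.Perm.decomposeOption.symm (none, σ)) x = x)).card = S.card + 1 := by
    have : Finset.univ.filter (fun x => (Equiv.Perm.decomposeOption.symm (none, σ)) x = x) =
        Finset.insertNone S := by
      ext x
      cases x <;> simp [hS]
    rw [this, Finset.card_insertNone]
  have e1 : ∀ y : α, (Finset.univ.filter (fun x =>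
      (Equiv.Perm.decomposeOption.symm (some y, σ)) x = x)).card = (S.erase y).card := by
    intro y
    have : Finset.univ.filter (fun x => (Equiv.Perm.decomposeOption.symm (some y, σ)) x = x) =
        (S.erase y).map Function.Embedding.some := by
      ext x
      cases x with
      | none => simp
      | some z =>
        simp only [Finset.mem_filter, Finset.mem_univ, true_and,
          Equiv.Perm.decomposeOption_symm_apply, Equiv.Perm.coe_mul, Function.comp_apply,
          Equiv.optionCongr_apply, Option.map_some, Finset.mem_map, Finset.mem_erase, hS,
          Function.Embedding.some_apply, Option.some.injEq, exists_eq_right]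
        by_cases hz : σ z = y
        · rw [hz, Equiv.swap_apply_right]
          simp only [reduceCtorEq, false_iff]
          rintro ⟨h1, h2⟩
          exact h1 h2.symm
        · rw [Equiv.swap_apply_of_ne_of_ne (by simp) (by simpa using hz), Option.some.injEq]
          constructor
          · intro h
            exact ⟨fun h' => hz (h.trans h'), h⟩
          · exact fun h => h.2
    rw [this, Finset.card_map]
  simp only [e0, e1]
  rw [add_assoc]
  congr 1
  rw [← Finset.sum_filter_add_sum_filter_not Finset.univ (fun y => y ∈ S)]
  congr 1
  · rw [Finset.sum_congr rfl (g := fun _ => φ (S.card - 1))]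
    · simp
    · intro x hx
      rw [Finset.card_erase_of_mem (by simpa using hx)]
  · rw [Finset.sum_congr rfl (g := fun _ => φ S.card)]
    · rw [Finset.sum_const, smul_eq_mul]
      congr 1
      rw [← Finset.card_compl]
      congr 1
      ext x; simp
    · intro x hx
      rw [Finset.erase_eq_of_notMem (by simpa using hx)]

open Equiv in
theorem sum_perm_congr {α β : Type} [Fintype α] [DecidableEq α] [Fintype β] [DecidableEq β]
    (e : α ≃ β) (φ : ℕ → ℕ) :
    ∑ σ : Perm α, φ (Finset.univ.filter (fun x => σ x = x)).card =
    ∑ σ : Perm β, φ (Finset.univ.filter (fun x => σ x = x)).card := by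
  rw [← Equiv.sum_comp (Equiv.permCongr e)]
  apply Finset.sum_congr rfl
  intro σ _
  congr 1
  apply Finset.card_equiv e
  intro i
  rw [Finset.mem_filter, Finset.mem_filter]
  simp

open Equiv in
theorem sum_perm_eq_words (n : ℕ) : ∀ (α : Type) [Fintype α] [DecidableEq α],
    Fintype.card α = n → ∀ φ : ℕ → ℕ,
    ∑ σ : Perm α, φ (Finset.univ.filter (fun x => σ x = x)).card =
    ((LL n).permutations'.map (fun w => φ (stat 0 w))).sum := by
  induction n with
  | zero =>
    intro α _ _ h φ
    have := Fintype.card_eq_zero_iff.1 h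
    simp [LL, stat]
  | succ n ih =>
    intro α _ _ h φ
    have e : α ≃ Option (Fin n) := Fintype.equivOfCardEq (by simp [h])
    rw [sum_perm_congr e, sum_perm_option, ih (Fin n) (by simp) (fun m => φ (m + 1) + m * φ (m - 1) +
      (Fintype.card (Fin n) - m) * φ m), sum_words_succ]
    simp

def permFun (n : ℕ) (σ : Equiv.Perm (Set.Icc 1 n)) (i : ℕ) : ℕ :=
  if h : 1 ≤ i ∧ i ≤ n then (σ ⟨i, h⟩ : ℕ) else 0

theorem permFun_val (n : ℕ) (σ : Equiv.Perm (Set.Icc 1 n)) (x : Set.Icc 1 n) :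
    permFun n σ x = σ x := by
  have := x.2
  rw [Set.mem_Icc] at this
  simp [permFun, this]

theorem permFun_isPermOn (n : ℕ) (σ : Equiv.Perm (Set.Icc 1 n)) : IsPermOn n (permFun n σ) := by
  refine ⟨⟨?_, ?_, ?_⟩, ?_⟩
  · intro i hi
    have := permFun_val n σ ⟨i, hi⟩
    simp only at this
    rw [this]
    exact (σ ⟨i, hi⟩).2
  · intro i hi j hj h
    have h1 := permFun_val n σ ⟨i, hi⟩
    have h2 := permFun_val n σ ⟨j, hj⟩
    simp only at h1 h2
    rw [h1, h2] at h
    have := σ.injective (Subtype.ext h)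
    simpa using this
  · intro j hj
    refine ⟨σ.symm ⟨j, hj⟩, (σ.symm ⟨j, hj⟩).2, ?_⟩
    rw [permFun_val]; simp
  · intro i hi
    rw [Set.mem_Icc] at hi
    simp [permFun, hi]

theorem permFun_surj (n : ℕ) (a : ℕ → ℕ) (ha : IsPermOn n a) : ∃ σ, permFun n σ = a := by
  refine ⟨ha.1.equiv, ?_⟩
  funext i
  by_cases hi : i ∈ Set.Icc 1 n
  · have := permFun_val n ha.1.equiv ⟨i, hi⟩
    simp only at this
    rw [this]; rfl
  · rw [ha.2 i hi]
    rw [Set.mem_Icc] at hi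
    simp [permFun, hi]

theorem permFun_inj (n : ℕ) : Function.Injective (permFun n) := by
  intro σ τ h
  ext x
  rw [← permFun_val, ← permFun_val, h]

theorem permFun_fix (n : ℕ) (σ : Equiv.Perm (Set.Icc 1 n)) :
    Set.ncard {i | 1 ≤ i ∧ i ≤ n ∧ permFun n σ i = i} =
      (Finset.univ.filter (fun x => σ x = x)).card := by
  rw [← Finset.card_map (Function.Embedding.subtype _), ← Set.ncard_coe_finset]
  congr 1
  ext i
  simp only [Set.mem_ofPred_eq, Finset.coe_map, Function.Embedding.subtype_apply, Finset.coe_filter,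
    Finset.mem_univ, true_and, Set.mem_image, Subtype.exists, exists_and_right, exists_eq_right]
  constructor
  · rintro ⟨h1, h2, h3⟩
    refine ⟨⟨h1, h2⟩, Subtype.ext ?_⟩
    rw [← permFun_val]; exact h3
  · rintro ⟨h1, h2⟩
    refine ⟨h1.1, h1.2, ?_⟩
    have := permFun_val n σ ⟨i, h1⟩
    simp only at this
    rw [this, h2]

theorem card_perm_side (n k : ℕ) :
    Nat.card {a : ℕ → ℕ // IsPermOn n a ∧ Set.ncard {i | 1 ≤ i ∧ i ≤ n ∧ a i = i} = k} =
    Nat.card {l : List ℕ // l.Perm (LL n) ∧ stat 0 l = k} := by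
  have e1 : Nat.card {σ : Equiv.Perm (Set.Icc 1 n) //
      (Finset.univ.filter (fun x => σ x = x)).card = k} =
      Nat.card {a : ℕ → ℕ // IsPermOn n a ∧ Set.ncard {i | 1 ≤ i ∧ i ≤ n ∧ a i = i} = k} := by
    refine Nat.card_eq_of_bijective
      (fun σ => ⟨permFun n σ.1, permFun_isPermOn n σ.1, by rw [permFun_fix]; exact σ.2⟩) ⟨?_, ?_⟩
    · intro σ τ h
      simp only [Subtype.mk.injEq] at h
      exact Subtype.ext (permFun_inj n h)
    · rintro ⟨a, ha, hk⟩
      obtain ⟨σ, rfl⟩ := permFun_surj n a ha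
      exact ⟨⟨σ, by rw [← permFun_fix]; exact hk⟩, rfl⟩
  have e2 : Nat.card {l : List ℕ // l.Perm (LL n) ∧ stat 0 l = k} =
      ((LL n).permutations'.map (fun w => (fun m => if m = k then 1 else 0) (stat 0 w))).sum := by
    rw [← List.sum_toFinset _ ((List.permutations_perm_permutations' _).nodup
      (List.nodup_permutations _ (nodup_LL n)))]
    simp only
    rw [← Finset.card_filter]
    refine Nat.subtype_card _ (fun l => ?_)
    simp [List.mem_permutations']
  rw [← e1, e2, ← sum_perm_eq_words n (Set.Icc 1 n) (by simp) (fun m => if m = k then 1 else 0), ← Finset.card_filter,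
    Nat.card_eq_fintype_card, Fintype.card_subtype]

theorem chain_lem_desc {C : ℕ → Prop} (t : ℕ) : ∀ (s : List ℕ) (v d : ℕ),
    (v :: s).IsChain (Ch C) → d ∈ s → d < t → t ≤ v → ∃ x ∈ s, ¬ C x ∧ x < t := by
  intro s
  induction s with
  | nil => simp
  | cons y ys ih =>
    intro v d hch hd hdt htv
    rw [List.isChain_cons_cons] at hch
    have hc : C y ↔ v < y := hch.1
    by_cases hy : y < t
    · exact ⟨y, by simp, by rw [hc]; omega, hy⟩
    · have hd' : d ∈ ys := by
        rcases List.mem_cons.1 hd with h | h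
        · omega
        · exact h
      obtain ⟨x, h1, h2⟩ := ih y d hch.2 hd' hdt (by omega)
      exact ⟨x, by simp [h1], h2⟩

open Classical in
theorem Ori.stat_eq {n : ℕ} {C : ℕ → Prop} {E : ℕ → ℕ → Prop} (h : Ori n C E) :
    ∀ (l : List ℕ) (v : ℕ), l.Nodup → (v :: l).IsChain (Ch C) → l.Pairwise (Pw E) →
    (∀ z ∈ l, z ≤ n) →
    stat v l = (l.toFinset.filter (fun c => C c ∧ ∀ x ∈ l, ¬ E c x)).card := by
  intro l
  induction l with
  | nil => simp [stat]
  | cons y ys ih =>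
    intro v nd hch hpw hn
    rw [List.isChain_cons_cons] at hch
    rw [List.pairwise_cons] at hpw
    rw [List.nodup_cons] at nd
    have hc : C y ↔ v < y := hch.1
    have key : (v < y ∧ ∀ d ∈ ys, y < d) ↔ (C y ∧ ∀ x ∈ y :: ys, ¬ E y x) := by
      rw [hc]
      refine and_congr_right fun hvy => ?_
      have hCy := hc.2 hvy
      constructor
      · intro hd x hx hE
        have : ¬ C x ∧ x < y := by
          rcases h.edge _ _ hE with h1 | h1
          · exact absurd hCy h1.1
          · exact h1.2
        rcases List.mem_cons.1 hx with h1 | h1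
        · omega
        · have := hd x h1
          omega
      · intro hx d hd
        by_contra hdy
        have hne : d ≠ y := by
          rintro rfl
          exact nd.1 hd
        obtain ⟨x, hxs, hxC, hxy⟩ := chain_lem_desc y ys y d hch.2 hd (by omega) le_rfl
        rcases h.tot x y hxy (hn y (by simp)) hxC hCy with h1 | h1
        · exact hpw.1 x hxs h1
        · exact hx x (by simp [hxs]) h1
    have rest : ∀ c ∈ ys, (C c ∧ ∀ x ∈ y :: ys, ¬ E c x) ↔ (C c ∧ ∀ x ∈ ys, ¬ E c x) := by
      intro c hcs
      refine and_congr_right fun _ => ?_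
      have := hpw.1 c hcs
      simp only [List.mem_cons, forall_eq_or_imp]
      exact and_iff_right this
    rw [stat, ih y nd.2 hch.2 hpw.2 (fun z hz => hn z (by simp [hz]))]
    rw [List.toFinset_cons, Finset.filter_insert]
    have e : ys.toFinset.filter (fun c => C c ∧ ∀ x ∈ y :: ys, ¬ E c x) =
        ys.toFinset.filter (fun c => C c ∧ ∀ x ∈ ys, ¬ E c x) := by
      apply Finset.filter_congr
      intro c hcs
      exact rest c (by simpa using hcs)
    rw [e]
    by_cases hb : (v < y ∧ ∀ d ∈ ys, y < d)
    · rw [if_pos hb, if_pos (key.1 hb), Finset.card_insert_of_notMem, add_comm]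
      simp [nd.1]
    · rw [if_neg hb, if_neg (fun h' => hb (key.2 h')), zero_add]

/-! ### labels -/

def rl (F : FerrersShape) (i : ℕ) : ℕ := i + (F.len 0 - F.len i)
def ht (F : FerrersShape) (j : ℕ) : ℕ := ((Finset.range F.r).filter (fun i => j < F.len i)).card
def cl (F : FerrersShape) (j : ℕ) : ℕ := F.len 0 - 1 - j + ht F j

theorem len_le (F : FerrersShape) (i : ℕ) : F.len i ≤ F.len 0 := by
  by_cases hi : i < F.r
  · exact F.anti 0 i (by omega) hi
  · rw [F.len_zero i (by omega)]; omega

theorem ht_iff (F : FerrersShape) {i : ℕ} (j : ℕ) (hi : i < F.r) : i < ht F j ↔ j < F.len i := by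
  constructor
  · intro h
    by_contra hj
    have : ht F j ≤ i := by
      rw [← Finset.card_range i]
      apply Finset.card_le_card
      intro x hx
      rw [Finset.mem_filter, Finset.mem_range] at hx
      rw [Finset.mem_range]
      by_contra hxi
      have := F.anti i x (by omega) hx.1
      omega
    omega
  · intro h
    have : i + 1 ≤ ht F j := by
      rw [← Finset.card_range (i + 1)]
      apply Finset.card_le_card
      intro x hx
      rw [Finset.mem_range] at hx
      rw [Finset.mem_filter, Finset.mem_range]
      have := F.anti x i (by omega) hi
      omega
    omega

theorem ht_le (F : FerrersShape) (j : ℕ) : ht F j ≤ F.r := by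
  rw [← Finset.card_range F.r]
  exact Finset.card_filter_le _ _

theorem ht_anti (F : FerrersShape) {j j' : ℕ} (h : j ≤ j') : ht F j' ≤ ht F j := by
  apply Finset.card_le_card
  intro x hx
  rw [Finset.mem_filter] at hx ⊢
  exact ⟨hx.1, by omega⟩

theorem rl_lt_cl (F : FerrersShape) {i j : ℕ} (hi : i < F.r) (hj : j < F.len i) :
    rl F i < cl F j := by
  have := (ht_iff F j hi).2 hj
  have := len_le F i
  unfold rl cl
  omega

theorem cl_lt_rl (F : FerrersShape) {i j : ℕ} (hi : i < F.r) (hj0 : j < F.len 0)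
    (hj : F.len i ≤ j) : cl F j < rl F i := by
  have := mt (ht_iff F j hi).1 (by omega)
  have := len_le F i
  unfold rl cl
  omega

theorem rl_zero (F : FerrersShape) : rl F 0 = 0 := by simp [rl]

theorem rl_strict (F : FerrersShape) {i i' : ℕ} (h : i < i') (hi : i' < F.r) :
    rl F i < rl F i' := by
  have := F.anti i i' h.le hi
  unfold rl
  omega

theorem rl_inj (F : FerrersShape) {i i' : ℕ} (hi : i < F.r) (hi' : i' < F.r)
    (h : rl F i = rl F i') : i = i' := by
  rcases lt_trichotomy i i' with h1 | h1 | h1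
  · have := rl_strict F h1 hi'
    omega
  · exact h1
  · have := rl_strict F h1 hi
    omega

theorem cl_strict (F : FerrersShape) {j j' : ℕ} (h : j < j') (hj : j' < F.len 0) :
    cl F j' < cl F j := by
  have := ht_anti F h.le
  unfold cl
  omega

theorem cl_inj (F : FerrersShape) {j j' : ℕ} (hi : j < F.len 0) (hi' : j' < F.len 0)
    (h : cl F j = cl F j') : j = j' := by
  rcases lt_trichotomy j j' with h1 | h1 | h1
  · have := cl_strict F h1 hi'
    omega
  · exact h1
  · have := cl_strict F h1 hi
    omega

theorem rl_ne_cl (F : FerrersShape) {i j : ℕ} (hi : i < F.r) (hj : j < F.len 0) :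
    rl F i ≠ cl F j := by
  by_cases h : j < F.len i
  · exact (rl_lt_cl F hi h).ne
  · exact (cl_lt_rl F hi hj (by omega)).ne'

theorem lt_of_rl_lt (F : FerrersShape) {i j : ℕ} (hi : i < F.r) (hj : j < F.len 0)
    (h : rl F i < cl F j) : j < F.len i := by
  by_contra h'
  have := cl_lt_rl F hi hj (by omega)
  omega

def TC (F : FerrersShape) (b : ℕ) : Prop := ∃ j, j < F.len 0 ∧ b = cl F j

theorem not_TC_rl (F : FerrersShape) {i : ℕ} (hi : i < F.r) : ¬ TC F (rl F i) := by
  rintro ⟨j, hj, h⟩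
  exact rl_ne_cl F hi hj h

theorem rl_le (F : FerrersShape) {n i : ℕ} (hF : F.r + F.len 0 = n + 1) (hi : i < F.r) :
    rl F i ≤ n := by
  have := F.len_pos i hi
  have := len_le F i
  unfold rl
  omega

theorem cl_le (F : FerrersShape) {n j : ℕ} (hF : F.r + F.len 0 = n + 1) (hj : j < F.len 0) :
    cl F j ≤ n := by
  have := ht_le F j
  unfold cl
  omega

theorem cover (F : FerrersShape) {n : ℕ} (hF : F.r + F.len 0 = n + 1) (x : ℕ) (hx : x ≤ n) :
    TC F x ∨ ∃ i, i < F.r ∧ x = rl F i := by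
  have hd : Disjoint ((Finset.range F.r).image (rl F)) ((Finset.range (F.len 0)).image (cl F)) := by
    rw [Finset.disjoint_left]
    intro a ha hb
    rw [Finset.mem_image] at ha hb
    obtain ⟨i, hi, rfl⟩ := ha
    obtain ⟨j, hj, h⟩ := hb
    exact rl_ne_cl F (Finset.mem_range.1 hi) (Finset.mem_range.1 hj) h.symm
  have hsub : ((Finset.range F.r).image (rl F)) ∪ ((Finset.range (F.len 0)).image (cl F)) =
      Finset.range (n + 1) := by
    apply Finset.eq_of_subset_of_card_le
    · intro a ha
      rw [Finset.mem_union, Finset.mem_image, Finset.mem_image] at ha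
      rw [Finset.mem_range]
      rcases ha with ⟨i, hi, rfl⟩ | ⟨j, hj, rfl⟩
      · have := rl_le F hF (Finset.mem_range.1 hi)
        omega
      · have := cl_le F hF (Finset.mem_range.1 hj)
        omega
    · rw [Finset.card_union_of_disjoint hd, Finset.card_image_of_injOn, Finset.card_image_of_injOn]
      · simp [hF]
      · intro a ha b hb h
        exact cl_inj F (by simpa using ha) (by simpa using hb) h
      · intro a ha b hb h
        exact rl_inj F (by simpa using ha) (by simpa using hb) h
  have hx' : x ∈ Finset.range (n + 1) := by rw [Finset.mem_range]; omega
  rw [← hsub, Finset.mem_union, Finset.mem_image, Finset.mem_image] at hx'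
  rcases hx' with ⟨i, hi, rfl⟩ | ⟨j, hj, rfl⟩
  · exact Or.inr ⟨i, Finset.mem_range.1 hi, rfl⟩
  · exact Or.inl ⟨j, Finset.mem_range.1 hj, rfl⟩

def TE {F : FerrersShape} (T : EWTableau F) (x y : ℕ) : Prop :=
  ∃ i j, i < F.r ∧ j < F.len i ∧
    ((x = rl F i ∧ y = cl F j ∧ T.one i j = true) ∨ (x = cl F j ∧ y = rl F i ∧ T.one i j = false))

theorem TE_rc {F : FerrersShape} (T : EWTableau F) {i j : ℕ} (hi : i < F.r) (hj : j < F.len 0) :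
    TE T (rl F i) (cl F j) ↔ j < F.len i ∧ T.one i j = true := by
  constructor
  · rintro ⟨i', j', hi', hj', ⟨h1, h2, h3⟩ | ⟨h1, h2, h3⟩⟩
    · have e1 := rl_inj F hi hi' h1
      have e2 := cl_inj F hj (hj'.trans_le (len_le F i')) h2
      subst e1; subst e2
      exact ⟨hj', h3⟩
    · exact absurd h1 (rl_ne_cl F hi (hj'.trans_le (len_le F i')))
  · rintro ⟨h1, h2⟩
    exact ⟨i, j, hi, h1, Or.inl ⟨rfl, rfl, h2⟩⟩

theorem TE_cr {F : FerrersShape} (T : EWTableau F) {i j : ℕ} (hi : i < F.r) (hj : j < F.len 0) :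
    TE T (cl F j) (rl F i) ↔ j < F.len i ∧ T.one i j = false := by
  constructor
  · rintro ⟨i', j', hi', hj', ⟨h1, h2, h3⟩ | ⟨h1, h2, h3⟩⟩
    · exact absurd h2 (rl_ne_cl F hi (hj'.trans_le (len_le F i')))
    · have e1 := rl_inj F hi hi' h2
      have e2 := cl_inj F hj (hj'.trans_le (len_le F i')) h1
      subst e1; subst e2
      exact ⟨hj', h3⟩
  · rintro ⟨h1, h2⟩
    exact ⟨i, j, hi, h1, Or.inr ⟨rfl, rfl, h2⟩⟩

theorem no_cyc {F : FerrersShape} (T : EWTableau F) {i i' j j' : ℕ} (hi : i < F.r) (hi' : i' < F.r)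
    (h1 : j < F.len i ∧ T.one i j = true) (h2 : j < F.len i' ∧ T.one i' j = false)
    (h3 : j' < F.len i' ∧ T.one i' j' = true) (h4 : j' < F.len i ∧ T.one i j' = false) : False := by
  have hii : i ≠ i' := by rintro rfl; simp [h1.2] at h2
  have hjj : j ≠ j' := by rintro rfl; simp [h1.2] at h4
  rcases lt_or_gt_of_ne hii with a | a <;> rcases lt_or_gt_of_ne hjj with b | b
  · exact T.no_rect i i' j j' a hi' b h3.1 (by simp [h1.2, h2.2, h3.2, h4.2])
  · exact T.no_rect i i' j' j a hi' b h2.1 (by simp [h1.2, h2.2, h3.2, h4.2])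
  · exact T.no_rect i' i j j' a hi b h4.1 (by simp [h1.2, h2.2, h3.2, h4.2])
  · exact T.no_rect i' i j' j a hi b h1.1 (by simp [h1.2, h2.2, h3.2, h4.2])

theorem TE_cases {F : FerrersShape} (T : EWTableau F) {x y : ℕ} (h : TE T x y) :
    (∃ i j, i < F.r ∧ j < F.len 0 ∧ x = rl F i ∧ y = cl F j) ∨
    (∃ i j, i < F.r ∧ j < F.len 0 ∧ x = cl F j ∧ y = rl F i) := by
  obtain ⟨i, j, hi, hj, ⟨h1, h2, h3⟩ | ⟨h1, h2, h3⟩⟩ := h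
  · exact Or.inl ⟨i, j, hi, hj.trans_le (len_le F i), h1, h2⟩
  · exact Or.inr ⟨i, j, hi, hj.trans_le (len_le F i), h1, h2⟩

theorem TE_cyc_row {F : FerrersShape} (T : EWTableau F) {i b c d : ℕ} (hi : i < F.r)
    (h1 : TE T (rl F i) b) (h2 : TE T b c) (h3 : TE T c d) (h4 : TE T d (rl F i)) : False := by
  rcases TE_cases T h1 with ⟨_, j, _, hj, _, rfl⟩ | ⟨_, j, _, hj, h, _⟩
  swap
  · exact rl_ne_cl F hi hj h
  rcases TE_cases T h4 with ⟨_, j', _, hj', _, h⟩ | ⟨_, j', _, hj', rfl, _⟩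
  · exact rl_ne_cl F hi hj' h
  rcases TE_cases T h2 with ⟨i', _, hi', _, h, _⟩ | ⟨i', _, hi', _, _, rfl⟩
  · exact rl_ne_cl F hi' hj h.symm
  rw [TE_rc T hi hj] at h1
  rw [TE_cr T hi' hj] at h2
  rw [TE_rc T hi' hj'] at h3
  rw [TE_cr T hi hj'] at h4
  exact no_cyc T hi hi' h1 h2 h3 h4

theorem ori_of_tableau {F : FerrersShape} (T : EWTableau F) {n : ℕ} (hF : F.r + F.len 0 = n + 1) :
    Ori n (TC F) (TE T) where
  edge a b h := by
    obtain ⟨i, j, hi, hj, ⟨rfl, rfl, h3⟩ | ⟨rfl, rfl, h3⟩⟩ := h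
    · exact Or.inl ⟨not_TC_rl F hi, ⟨j, hj.trans_le (len_le F i), rfl⟩, rl_lt_cl F hi hj⟩
    · exact Or.inr ⟨⟨j, hj.trans_le (len_le F i), rfl⟩, not_TC_rl F hi, rl_lt_cl F hi hj⟩
  tot a b hab hb ha hb' := by
    obtain ⟨i, hi, rfl⟩ := (cover F hF a (by omega)).resolve_left ha
    obtain ⟨j, hj, rfl⟩ := hb'
    have hj' := lt_of_rl_lt F hi hj hab
    rw [TE_rc T hi hj, TE_cr T hi hj]
    cases T.one i j <;> simp [hj']
  asym a b h h' := by
    rcases TE_cases T h with ⟨i, j, hi, hj, rfl, rfl⟩ | ⟨i, j, hi, hj, rfl, rfl⟩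
    · rw [TE_rc T hi hj] at h
      rw [TE_cr T hi hj] at h'
      simp [h.2] at h'
    · rw [TE_cr T hi hj] at h
      rw [TE_rc T hi hj] at h'
      simp [h.2] at h'
  cyc a b c d h1 h2 h3 h4 := by
    rcases TE_cases T h1 with ⟨i, j, hi, hj, rfl, rfl⟩ | ⟨i, j, hi, hj, rfl, rfl⟩
    · exact TE_cyc_row T hi h1 h2 h3 h4
    · exact TE_cyc_row T hi h2 h3 h4 h1
  zero := by
    have := not_TC_rl F F.r_pos
    rwa [rl_zero] at this
  zrow b hb _ := by
    obtain ⟨j, hj, rfl⟩ := hb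
    have := (TE_rc T F.r_pos hj).2 ⟨hj, T.top_row j hj⟩
    rwa [rl_zero] at this
  row a ha h0 hn := by
    obtain ⟨i, hi, rfl⟩ := (cover F hF a (by omega)).resolve_left ha
    have hi0 : 0 < i := by
      rcases Nat.eq_zero_or_pos i with rfl | h
      · rw [rl_zero] at h0; omega
      · exact h
    obtain ⟨j, hj, hone⟩ := T.has_zero i hi0 hi
    have hj0 := hj.trans_le (len_le F i)
    exact ⟨cl F j, cl_le F hF hj0, (TE_cr T hi hj0).2 ⟨hj, hone⟩⟩

theorem allOne_card {F : FerrersShape} (T : EWTableau F) {n : ℕ} (hF : F.r + F.len 0 = n + 1)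
    (l : List ℕ) (nd : l.Nodup) (hm : ∀ x, x ∈ l ↔ 1 ≤ x ∧ x ≤ n)
    (hc : (0 :: l).IsChain (Ch (TC F))) (hp : (0 :: l).Pairwise (Pw (TE T))) :
    Set.ncard {j | j < F.len 0 ∧ ∀ i, i < F.r → j < F.len i → T.one i j = true} = stat 0 l := by
  classical
  rw [(ori_of_tableau T hF).stat_eq l 0 nd hc (List.pairwise_cons.1 hp).2
    (fun z hz => ((hm z).1 hz).2), ← Set.ncard_coe_finset]
  rw [← Set.InjOn.ncard_image (f := cl F)]
  · congr 1
    ext c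
    simp only [Set.mem_image, Set.mem_ofPred_eq, Finset.coe_filter, List.mem_toFinset]
    constructor
    · rintro ⟨j, ⟨hj, hone⟩, rfl⟩
      have h0 := rl_lt_cl F F.r_pos hj
      refine ⟨(hm _).2 ⟨by omega, cl_le F hF hj⟩, ⟨j, hj, rfl⟩, fun x hx hE => ?_⟩
      rcases TE_cases T hE with ⟨i, _, hi, _, h, _⟩ | ⟨i, _, hi, _, _, rfl⟩
      · exact rl_ne_cl F hi hj h.symm
      · rw [TE_cr T hi hj] at hE
        simp [hone i hi hE.1] at hE
    · rintro ⟨hcl, ⟨j, hj, rfl⟩, hx⟩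
      refine ⟨j, ⟨hj, fun i hi hji => ?_⟩, rfl⟩
      by_cases hi0 : i = 0
      · subst hi0; exact T.top_row j hj
      · have h1 := rl_strict F (show 0 < i by omega) hi
        have h2 := hx (rl F i) ((hm _).2 ⟨by omega, rl_le F hF hi⟩)
        rw [TE_cr T hi hj] at h2
        simpa [hji] using h2
  · intro a ha b hb h
    exact cl_inj F ha.1 hb.1 h

def WC (l : List ℕ) (b : ℕ) : Prop := (0 :: l).getD ((0 :: l).idxOf b - 1) 0 < b

theorem WC_chain (l : List ℕ) (nd : (0 :: l).Nodup) : (0 :: l).IsChain (Ch (WC l)) := by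
  rw [List.isChain_iff_getElem]
  intro i hi
  unfold Ch WC
  rw [nd.idxOf_getElem (i + 1) hi, Nat.add_sub_cancel, List.getD_eq_getElem _ _ (by omega)]

theorem WC_zero (l : List ℕ) : ¬ WC l 0 := by simp [WC]

theorem chain_max {C : ℕ → Prop} (n : ℕ) : ∀ (l : List ℕ) (v : ℕ), (v :: l).IsChain (Ch C) →
    (v :: l).Nodup → (∀ x ∈ v :: l, x ≤ n) → n ∈ l → C n := by
  intro l
  induction l with
  | nil => simp
  | cons y ys ih =>
    intro v hch nd hle hn
    rw [List.isChain_cons_cons] at hch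
    have hc : C y ↔ v < y := hch.1
    rw [List.nodup_cons] at nd
    by_cases hy : n = y
    · subst hy
      rw [hc]
      have := hle v (by simp)
      have hne : v ≠ n := by
        rintro rfl
        exact nd.1 (by simp)
      omega
    · exact ih y hch.2 nd.2 (fun x hx => hle x (List.mem_cons_of_mem _ hx)) (by simpa [hy] using hn)

theorem chain_congr {C C' : ℕ → Prop} : ∀ (l : List ℕ) (v : ℕ), (v :: l).IsChain (Ch C) →
    (v :: l).IsChain (Ch C') → ∀ b ∈ l, C b ↔ C' b := by
  intro l
  induction l with
  | nil => simp
  | cons y ys ih =>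
    intro v h1 h2 b hb
    rw [List.isChain_cons_cons] at h1 h2
    have c1 : C y ↔ v < y := h1.1
    have c2 : C' y ↔ v < y := h2.1
    rcases List.mem_cons.1 hb with h | h
    · rw [h, c1, c2]
    · exact ih y h1.2 h2.2 b h

theorem chain_transfer {C C' : ℕ → Prop} : ∀ (l : List ℕ) (v : ℕ), (v :: l).IsChain (Ch C) →
    (∀ b ∈ l, C b ↔ C' b) → (v :: l).IsChain (Ch C') := by
  intro l
  induction l with
  | nil => simp
  | cons y ys ih =>
    intro v h1 h2
    rw [List.isChain_cons_cons] at h1 ⊢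
    have c1 : C y ↔ v < y := h1.1
    exact ⟨(h2 y (by simp)).symm.trans c1, ih y h1.2 (fun b hb => h2 b (by simp [hb]))⟩

theorem chain_zero {C : ℕ → Prop} (P : ℕ → ℕ → Prop) (x : ℕ) (hx : ¬ C x) :
    ∀ (l : List ℕ) (v : ℕ),
    (v :: l).IsChain (Ch C) → (v :: l).Nodup → (v :: l).Pairwise P → x ∈ l →
    ∃ c ∈ v :: l, (C c ∨ c = v) ∧ x < c ∧ P c x := by
  intro l
  induction l with
  | nil => simp
  | cons y ys ih =>
    intro v hch nd hp hxl
    rw [List.isChain_cons_cons] at hch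
    have hc : C y ↔ v < y := hch.1
    rw [List.nodup_cons] at nd
    rw [List.pairwise_cons] at hp
    have hne : x ≠ v := by
      rintro rfl
      exact nd.1 hxl
    rcases List.mem_cons.1 hxl with h | h
    · subst h
      rw [hc] at hx
      exact ⟨v, by simp, Or.inr rfl, by omega, hp.1 x (by simp)⟩
    · obtain ⟨c, h1, h2, h3, h4⟩ := ih y hch.2 nd.2 hp.2 h
      by_cases hCc : C c
      · exact ⟨c, List.mem_cons_of_mem _ h1, Or.inl hCc, h3, h4⟩
      · have hcy : c = y := h2.resolve_left hCc
        subst hcy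
        rw [hc] at hCc
        exact ⟨v, by simp, Or.inr rfl, by omega, hp.1 x hxl⟩

theorem pairwise_idx (l : List ℕ) (nd : l.Nodup) :
    l.Pairwise (fun a b => l.idxOf a < l.idxOf b) := by
  rw [List.pairwise_iff_getElem]
  intro i j hi hj hij
  rwa [nd.idxOf_getElem i hi, nd.idxOf_getElem j hj]

theorem exists_shape (n : ℕ) (hn : 0 < n) (C : ℕ → Prop) (h0 : ¬ C 0) (hCn : C n) :
    ∃ F : FerrersShape, F.r + F.len 0 = n + 1 ∧ ∀ b, b ≤ n → (TC F b ↔ C b) := by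
  classical
  set p : ℕ → Prop := fun x => x ≤ n ∧ ¬ C x with hp
  have hf : (Set.ofPred p).Finite := (Set.finite_Iic n).subset (fun x hx => hx.1)
  set r := hf.toFinset.card with hr
  set f := Nat.nth p with hfdef
  have fp : ∀ i, i < r → p (f i) := fun i hi => Nat.nth_mem_of_lt_card hf hi
  have fs : ∀ i j, i < j → j < r → f i < f j := fun i j hij hj =>
    Nat.nth_strictMonoOn hf (hij.trans hj) hj hij
  have fsurj : ∀ x, p x → ∃ i, i < r ∧ f i = x := fun x hx =>
    Nat.exists_lt_card_finite_nth_eq hf hx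
  have fgap : ∀ d i, i + d < r → f i + d ≤ f (i + d) := by
    intro d
    induction d with
    | zero => intro i _; simp
    | succ d ih =>
      intro i hi
      have := ih i (by omega)
      have := fs (i + d) (i + (d + 1)) (by omega) hi
      omega
  obtain ⟨i0, hi0, hfi0⟩ := fsurj 0 ⟨by omega, h0⟩
  have f0 : f 0 = 0 := by
    by_cases h : i0 = 0
    · rwa [h] at hfi0
    · have := fs 0 i0 (by omega) hi0
      omega
  have fn : ∀ i, i < r → f i < n := by
    intro i hi
    have h1 := fp i hi
    have h2 : f i ≠ n := fun h => h1.2 (by rw [h]; exact hCn)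
    have := h1.1
    omega
  have fub : ∀ i, i < r → f i + r ≤ n + i := by
    intro i hi
    have h1 := fgap (r - 1 - i) i (by omega)
    have h2 := fn (i + (r - 1 - i)) (by omega)
    omega
  have flb : ∀ i, i < r → i ≤ f i := by
    intro i hi
    have := fgap i 0 (by omega)
    simp only [Nat.zero_add] at this
    omega
  have hrn := fub 0 (by omega)
  let F : FerrersShape :=
    { r := r
      len := fun i => if i < r then n + 1 - r + i - f i else 0
      r_pos := by omega
      anti := by
        intro i j hij hj
        have h1 := fgap (j - i) i (by omega)
        have h2 : i + (j - i) = j := by omega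
        rw [h2] at h1
        have h3 : i < r := by omega
        simp only [if_pos hj, if_pos h3]
        omega
      len_pos := by
        intro i hi
        have := fub i hi
        simp only [if_pos hi]
        omega
      len_zero := by
        intro i hi
        simp only [if_neg (by omega : ¬ i < r)] }
  have hFr : F.r = r := rfl
  have hFlen : ∀ i, i < r → F.len i = n + 1 - r + i - f i := fun i hi => if_pos hi
  have hFlen0 : F.len 0 = n + 1 - r := by
    rw [hFlen 0 (by omega), f0]; omega
  have hF : F.r + F.len 0 = n + 1 := by rw [hFr, hFlen0]; omega
  have hrl : ∀ i, i < r → rl F i = f i := by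
    intro i hi
    have := fub i hi
    have := flb i hi
    unfold rl
    rw [hFlen0, hFlen i hi]
    omega
  refine ⟨F, hF, fun b hb => ⟨fun h => ?_, fun h => ?_⟩⟩
  · by_contra hC
    obtain ⟨i, hi, rfl⟩ := fsurj b ⟨hb, hC⟩
    rw [← hrl i hi] at h
    exact not_TC_rl F hi h
  · refine (cover F hF b hb).resolve_right ?_
    rintro ⟨i, hi, rfl⟩
    rw [hrl i hi] at h
    exact (fp i hi).2 h

def EwRel {F : FerrersShape} (T : EWTableau F) (l : List ℕ) : Prop :=
  (0 :: l).IsChain (Ch (TC F)) ∧ (0 :: l).Pairwise (Pw (TE T))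

theorem exists_tableau (n : ℕ) (hn : 0 < n) (l : List ℕ) (nd : l.Nodup)
    (hm : ∀ x, x ∈ l ↔ 1 ≤ x ∧ x ≤ n) :
    ∃ T : Σ F : FerrersShape, EWTableau F, T.1.r + T.1.len 0 = n + 1 ∧ EwRel T.2 l := by
  have nd0 : (0 :: l).Nodup := by
    rw [List.nodup_cons]
    refine ⟨fun h => ?_, nd⟩
    have := (hm 0).1 h
    omega
  have hch := WC_chain l nd0
  have hle : ∀ x ∈ 0 :: l, x ≤ n := by
    intro x hx
    rcases List.mem_cons.1 hx with h | h
    · omega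
    · exact ((hm x).1 h).2
  have hCn := chain_max n l 0 hch nd0 hle ((hm n).2 ⟨hn, le_rfl⟩)
  obtain ⟨F, hF, hFC⟩ := exists_shape n hn (WC l) (WC_zero l) hCn
  have hch' : (0 :: l).IsChain (Ch (TC F)) :=
    chain_transfer l 0 hch (fun b hb => (hFC b ((hm b).1 hb).2).symm)
  have hpi := pairwise_idx (0 :: l) nd0
  set L := 0 :: l with hL
  let T : EWTableau F :=
    { one := fun i j => decide (i < F.r ∧ j < F.len i ∧ L.idxOf (rl F i) < L.idxOf (cl F j))
      support := by
        intro i j h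
        have := of_decide_eq_true h
        exact ⟨this.1, this.2.1⟩
      top_row := by
        intro j hj
        apply decide_eq_true
        refine ⟨F.r_pos, hj, ?_⟩
        have h1 := rl_lt_cl F F.r_pos hj
        rw [rl_zero] at h1 ⊢
        have h2 : cl F j ∈ l := (hm _).2 ⟨h1, cl_le F hF hj⟩
        exact (List.pairwise_cons.1 hpi).1 _ h2
      has_zero := by
        intro i hi0 hi
        have h1 := rl_strict F hi0 hi
        obtain ⟨c, hc1, hc2, hc3, hc4⟩ := chain_zero _ (rl F i) (not_TC_rl F hi) l 0 hch' nd0 hpi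
          ((hm _).2 ⟨by omega, rl_le F hF hi⟩)
        have hc5 : TC F c := by
          rcases hc2 with h | h
          · exact h
          · omega
        obtain ⟨j, hj, rfl⟩ := hc5
        refine ⟨j, lt_of_rl_lt F hi hj hc3, ?_⟩
        apply decide_eq_false
        rintro ⟨_, _, h⟩
        omega
      no_rect := by
        intro i i' j j' hii hi' hjj hj'
        have a1 : i < F.r := by omega
        have hl := F.anti i i' hii.le hi'
        have a2 : j < F.len i' := by omega
        have a3 : j < F.len i := by omega
        have a4 : j' < F.len i := by omega
        simp only [a1, hi', a2, a3, a4, hj', true_and, decide_eq_decide, ne_eq]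
        omega }
  refine ⟨⟨F, T⟩, hF, hch', hpi.imp ?_⟩
  intro a b hab
  rintro ⟨i, j, hi, hj, ⟨rfl, rfl, h3⟩ | ⟨rfl, rfl, h3⟩⟩
  · exact absurd (of_decide_eq_true h3).2.2 (Nat.lt_asymm hab)
  · exact of_decide_eq_false h3 ⟨hi, hj, hab⟩

theorem enum_unique {f g : ℕ → ℕ} {r : ℕ} (hf : ∀ i j, i < j → j < r → f i < f j)
    (hg : ∀ i j, i < j → j < r → g i < g j) (hfg : ∀ i, i < r → ∃ k, k < r ∧ f i = g k)
    (hgf : ∀ i, i < r → ∃ k, k < r ∧ g i = f k) : ∀ i, i < r → f i = g i := by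
  intro i
  induction i using Nat.strong_induction_on with
  | _ i ih =>
    intro hi
    obtain ⟨k, hk, hk'⟩ := hfg i hi
    obtain ⟨m, hm, hm'⟩ := hgf i hi
    rcases lt_trichotomy k i with h | h | h
    · have := ih k h hk
      have := hf k i h hi
      omega
    · rw [hk', h]
    · have := hg i k h hk
      rcases lt_trichotomy m i with h' | h' | h'
      · have := ih m h' hm
        have := hg m i h' hi
        omega
      · rw [hm', h']
      · have := hf i m h' hm
        omega

theorem shape_unique (n : ℕ) (F F' : FerrersShape) (hF : F.r + F.len 0 = n + 1)
    (hF' : F'.r + F'.len 0 = n + 1) (h : ∀ b, b ≤ n → (TC F b ↔ TC F' b)) : F = F' := by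
  have himg : ∀ (F F' : FerrersShape), F.r + F.len 0 = n + 1 → F'.r + F'.len 0 = n + 1 →
      (∀ b, b ≤ n → (TC F b ↔ TC F' b)) → ∀ i, i < F.r → ∃ k, k < F'.r ∧ rl F i = rl F' k := by
    intro F F' hF hF' h i hi
    have hle := rl_le F hF hi
    refine (cover F' hF' (rl F i) hle).resolve_left ?_
    rw [← h _ hle]
    exact not_TC_rl F hi
  have i1 := himg F F' hF hF' h
  have i2 := himg F' F hF' hF (fun b hb => (h b hb).symm)
  have hcard : ∀ F : FerrersShape, ((Finset.range F.r).image (rl F)).card = F.r := by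
    intro F
    rw [Finset.card_image_of_injOn, Finset.card_range]
    intro a ha b hb h
    exact rl_inj F (by simpa using ha) (by simpa using hb) h
  have hr : F.r = F'.r := by
    rw [← hcard F, ← hcard F']
    congr 1
    ext x
    simp only [Finset.mem_image, Finset.mem_range]
    constructor
    · rintro ⟨i, hi, rfl⟩
      obtain ⟨k, hk, hk'⟩ := i1 i hi
      exact ⟨k, hk, hk'.symm⟩
    · rintro ⟨i, hi, rfl⟩
      obtain ⟨k, hk, hk'⟩ := i2 i hi
      exact ⟨k, hk, hk'.symm⟩
  have hrl : ∀ i, i < F.r → rl F i = rl F' i := by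
    apply enum_unique (fun i j hij hj => rl_strict F hij hj)
      (fun i j hij hj => rl_strict F' hij (hr ▸ hj))
    · intro i hi
      rw [hr]
      exact i1 i hi
    · intro i hi
      exact i2 i (hr ▸ hi)
  have hlen : F.len = F'.len := by
    funext i
    by_cases hi : i < F.r
    · have h1 := hrl i hi
      have := len_le F i
      have := len_le F' i
      unfold rl at h1
      omega
    · rw [F.len_zero i (by omega), F'.len_zero i (by omega)]
  cases F
  cases F'
  simp only at hr hlen
  subst hr
  subst hlen
  rfl

theorem tableau_unique (n : ℕ) (l : List ℕ) (hm : ∀ x, x ∈ l ↔ 1 ≤ x ∧ x ≤ n)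
    (T T' : Σ F : FerrersShape, EWTableau F) (hT : T.1.r + T.1.len 0 = n + 1)
    (hT' : T'.1.r + T'.1.len 0 = n + 1) (h : EwRel T.2 l) (h' : EwRel T'.2 l) : T = T' := by
  obtain ⟨F, T⟩ := T
  obtain ⟨F', T'⟩ := T'
  simp only at hT hT' h h'
  have hFF : F = F' := by
    apply shape_unique n F F' hT hT'
    intro b hb
    rcases Nat.eq_zero_or_pos b with rfl | hb0
    · exact iff_of_false (ori_of_tableau T hT).zero (ori_of_tableau T' hT').zero
    · exact chain_congr l 0 h.1 h'.1 b ((hm b).2 ⟨hb0, hb⟩)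
  subst hFF
  have hone : T.one = T'.one := by
    funext i j
    by_cases hij : i < F.r ∧ j < F.len i
    · obtain ⟨hi, hj⟩ := hij
      have hj0 := hj.trans_le (len_le F i)
      have hlt := rl_lt_cl F hi hj
      have hpw : (0 :: l).Pairwise (fun a b =>
          (Pw (TE T) a b ∧ Pw (TE T') a b) ∨ (Pw (TE T) b a ∧ Pw (TE T') b a)) :=
        (h.2.and h'.2).imp (fun hab => Or.inl hab)
      have hmem : ∀ x, x ≤ n → x ∈ 0 :: l := by
        intro x hx
        rcases Nat.eq_zero_or_pos x with rfl | hx0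
        · simp
        · exact List.mem_cons_of_mem _ ((hm x).2 ⟨hx0, hx⟩)
      have hsymm : Std.Symm (fun a b : ℕ =>
          (Pw (TE T) a b ∧ Pw (TE T') a b) ∨ (Pw (TE T) b a ∧ Pw (TE T') b a)) :=
        ⟨fun a b hab => Or.symm hab⟩
      have := List.Pairwise.forall hpw (hmem _ (rl_le F hT hi))
        (hmem _ (cl_le F hT hj0)) hlt.ne
      unfold Pw at this
      rw [TE_cr T hi hj0, TE_cr T' hi hj0, TE_rc T hi hj0, TE_rc T' hi hj0] at this
      revert this
      cases T.one i j <;> cases T'.one i j <;> simp [hj]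
    · have e1 : T.one i j = false := by
        by_contra hc
        exact hij (T.support i j (by simpa using hc))
      have e2 : T'.one i j = false := by
        by_contra hc
        exact hij (T'.support i j (by simpa using hc))
      rw [e1, e2]
  cases T
  cases T'
  simp only at hone
  subst hone
  rfl

theorem perm_LL_iff (n : ℕ) (l : List ℕ) :
    l.Perm (LL n) ↔ l.Nodup ∧ ∀ x, x ∈ l ↔ 1 ≤ x ∧ x ≤ n := by
  constructor
  · intro h
    exact ⟨h.nodup_iff.2 (nodup_LL n), fun x => by rw [h.mem_iff, mem_LL]⟩
  · rintro ⟨h1, h2⟩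
    rw [List.perm_ext_iff_of_nodup h1 (nodup_LL n)]
    intro x
    rw [h2, mem_LL]

theorem card_tableau_side (n k : ℕ) (hn : 0 < n) :
    Nat.card {T : Σ F : FerrersShape, EWTableau F //
        T.1.r + T.1.len 0 = n + 1 ∧
        Set.ncard {j | j < T.1.len 0 ∧
          ∀ i, i < T.1.r → j < T.1.len i → T.2.one i j = true} = k}
      = Nat.card {l : List ℕ // l.Perm (LL n) ∧ stat 0 l = k} := by
  symm
  have hex : ∀ l : {l : List ℕ // l.Perm (LL n) ∧ stat 0 l = k},
      ∃ T : Σ F : FerrersShape, EWTableau F, T.1.r + T.1.len 0 = n + 1 ∧ EwRel T.2 l.1 := by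
    rintro ⟨l, hl, _⟩
    rw [perm_LL_iff] at hl
    exact exists_tableau n hn l hl.1 hl.2
  choose g hg1 hg2 using hex
  refine Nat.card_eq_of_bijective (fun l => ⟨g l, hg1 l, ?_⟩) ⟨?_, ?_⟩
  · have hl := (perm_LL_iff n l.1).1 l.2.1
    rw [allOne_card (g l).2 (hg1 l) l.1 hl.1 hl.2 (hg2 l).1 (hg2 l).2]
    exact l.2.2
  · intro l l' h
    simp only [Subtype.mk.injEq] at h
    have hl := (perm_LL_iff n l.1).1 l.2.1
    have hl' := (perm_LL_iff n l'.1).1 l'.2.1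
    have r1 := hg2 l
    have r2 := hg2 l'
    rw [← h] at r2
    apply Subtype.ext
    exact (ori_of_tableau (g l).2 (hg1 l)).unique_word l.1 l'.1 0 hl.1 hl'.1
      (fun z => (hl.2 z).trans (hl'.2 z).symm) (fun z hz => ((hl.2 z).1 hz).2) r1.1 r2.1
      (List.pairwise_cons.1 r1.2).2 (List.pairwise_cons.1 r2.2).2
  · rintro ⟨T, hT, hk⟩
    obtain ⟨l, nd, hm, hc, hp⟩ := (ori_of_tableau T.2 hT).exists_word
    have hst : stat 0 l = k := by
      rw [← allOne_card T.2 hT l nd hm hc hp]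
      exact hk
    refine ⟨⟨l, (perm_LL_iff n l).2 ⟨nd, hm⟩, hst⟩, Subtype.ext ?_⟩
    exact tableau_unique n l hm _ _ (hg1 _) hT (hg2 _) ⟨hc, hp⟩


/-- for every `n ≥ 1` and `k ≥ 0`, the number of EW-tableaux of size
`n` having exactly `k` columns all of whose cells contain 1 equals the number of
`n`-permutations with exactly `k` fixed points. -/
theorem ewTableaux_allOneColumns_eq_fixedPoints (n k : ℕ) (hn : 0 < n) :
    Nat.card {T : Σ F : FerrersShape, EWTableau F //
        T.1.r + T.1.len 0 = n + 1 ∧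
        Set.ncard {j | j < T.1.len 0 ∧
          ∀ i, i < T.1.r → j < T.1.len i → T.2.one i j = true} = k}
      = Nat.card {a : ℕ → ℕ // IsPermOn n a ∧
          Set.ncard {i | 1 ≤ i ∧ i ≤ n ∧ a i = i} = k} := by
  rw [card_tableau_side n k hn, card_perm_side n k]
end
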